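/- arXiv:1208.1470 — 2 statements merged into one kernel-verified Lean document; each statement's English description precedes it below -/
import Mathlib

section
/- For every integer n ≥ 2, every integer k ≥ 2, every exponent 1 < p ≤ 2 and every integer m ≥ 1 there exist constants ε > 0 and C > 0, depending only on n, k, p, m, with the following property: if z₀ = (x₀,t₀) ∈ ℝⁿ × ℝ, R₀ > 0, and u : P_{R₀}(z₀) → ℝ^k is a smooth solution of the harmonic map heat flow into the unit sphere S^{k−1} satisfying the parabolic Morrey smallness condition sup { (r^{p−n−2} ∫_{P_r(z)} |∇u|^p)^{1/p} + (r^{2p−n−2} ∫_{P_r(z)} |∂_t u|^p)^{1/p} : z ∈ P_{R₀}(z₀), 0 < r ≤ R₀, P_r(z) ⊆ P_{R₀}(z₀) } ≤ ε, then the m-th spatial derivative of u satisfies |∇^m u|(z₀) ≤ C ε / R₀^m. -/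
open MeasureTheory Metric Set Filter Real

noncomputable section

abbrev Sp (n : ℕ) := EuclideanSpace ℝ (Fin n)

/-- The `α`-th spatial coordinate direction in spacetime `ℝⁿ × ℝ`. -/
def sdir (n : ℕ) (α : Fin n) : Sp n × ℝ := (EuclideanSpace.single α 1, 0)

/-- The time direction in spacetime `ℝⁿ × ℝ`. -/
def tdir (n : ℕ) : Sp n × ℝ := (0, 1)

/-- Directional derivative of the `i`-th component of `u` in direction `v`. -/
def pd {n k : ℕ} (u : Sp n × ℝ → Fin k → ℝ) (i : Fin k) (v : Sp n × ℝ) (z : Sp n × ℝ) : ℝ :=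
  fderiv ℝ (fun w => u w i) z v

/-- Squared spatial gradient `|∇u|²`. -/
def gradSq {n k : ℕ} (u : Sp n × ℝ → Fin k → ℝ) (z : Sp n × ℝ) : ℝ :=
  ∑ α : Fin n, ∑ i : Fin k, (pd u i (sdir n α) z) ^ 2

/-- Squared time derivative `|∂ₜu|²`. -/
def dtSq {n k : ℕ} (u : Sp n × ℝ → Fin k → ℝ) (z : Sp n × ℝ) : ℝ :=
  ∑ i : Fin k, (pd u i (tdir n) z) ^ 2

/-- Spatial Laplacian `Δuⁱ`. -/
def lap {n k : ℕ} (u : Sp n × ℝ → Fin k → ℝ) (i : Fin k) (z : Sp n × ℝ) : ℝ :=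
  ∑ α : Fin n, fderiv ℝ (pd u i (sdir n α)) z (sdir n α)

/-- `u` takes values in the unit sphere `S^{k-1}` on `D`. -/
def SphereValued {n k : ℕ} (u : Sp n × ℝ → Fin k → ℝ) (D : Set (Sp n × ℝ)) : Prop :=
  ∀ z ∈ D, ∑ i : Fin k, (u z i) ^ 2 = 1

/-- `u` solves the harmonic map heat flow `∂ₜu = Δu + |∇u|² u` into the sphere on `D`. -/
def HeatFlow {n k : ℕ} (u : Sp n × ℝ → Fin k → ℝ) (D : Set (Sp n × ℝ)) : Prop :=
  ∀ z ∈ D, ∀ i : Fin k, pd u i (tdir n) z = lap u i z + gradSq u z * u z i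

/-- Parabolic cylinder `P_r(z₀) = closedBall(x₀,r) × (t₀ - r², t₀]`. -/
def pcyl {n : ℕ} (z₀ : Sp n × ℝ) (r : ℝ) : Set (Sp n × ℝ) :=
  closedBall z₀.1 r ×ˢ Ioc (z₀.2 - r ^ 2) z₀.2

open scoped Topology

/-! ### Spacetime differential operators -/

/-- The spatial differential of a map on spacetime. -/
def spatialFDeriv {n : ℕ} {E : Type*} [NormedAddCommGroup E] [NormedSpace ℝ E]
    (V : Sp n × ℝ → E) (z : Sp n × ℝ) : Sp n →L[ℝ] E :=
  (fderiv ℝ V z).comp (ContinuousLinearMap.inl ℝ (Sp n) ℝ)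

/-- The spatial Laplacian of a map on spacetime. -/
def spatialLaplacian {n : ℕ} {E : Type*} [NormedAddCommGroup E] [NormedSpace ℝ E]
    (V : Sp n × ℝ → E) (z : Sp n × ℝ) : E :=
  ∑ α : Fin n, fderiv ℝ (fun w => fderiv ℝ V w (sdir n α)) z (sdir n α)

/-- The compact parabolic cylinder with top centre `z`. -/
def closedCyl {n : ℕ} (z : Sp n × ℝ) (r : ℝ) : Set (Sp n × ℝ) :=
  closedBall z.1 r ×ˢ Icc (z.2 - r ^ 2) z.2

/-! ### The interior gradient estimate for the inhomogeneous heat equation -/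

lemma IsLocalMax.second_deriv_nonpos {h h' : ℝ → ℝ} {c : ℝ} (hmax : IsLocalMax h 0)
    (h1 : ∀ᶠ s in 𝓝 (0 : ℝ), HasDerivAt h (h' s) s) (h2 : HasDerivAt h' c 0) : c ≤ 0 := by
  by_contra! hc
  have hd : deriv h =ᶠ[𝓝 0] h' := h1.mono fun s hs => hs.deriv
  have hdd : deriv (deriv h) 0 = c := by rw [hd.deriv_eq, h2.deriv]
  have h0 : deriv h 0 = 0 := hmax.deriv_eq_zero
  have hmin : IsLocalMin h 0 :=
    isLocalMin_of_deriv_deriv_pos (by rw [hdd]; exact hc) h0 h1.self_of_nhds.continuousAt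
  have hconst : h =ᶠ[𝓝 0] fun _ => h 0 := by
    filter_upwards [hmax, hmin] with s hs1 hs2 using le_antisymm hs1 hs2
  have hz : deriv h =ᶠ[𝓝 0] fun _ => 0 := by
    have := hconst.deriv
    simpa using this
  have : deriv (deriv h) 0 = 0 := by rw [hz.deriv_eq]; simp
  linarith

section Lines

variable {E F : Type*} [NormedAddCommGroup E] [NormedSpace ℝ E] [NormedAddCommGroup F]
  [NormedSpace ℝ F] {V : E → F} {Ω : Set E} {z : E}

lemma ContDiffOn.fderiv_apply_infty (hΩ : IsOpen Ω) (hV : ContDiffOn ℝ (⊤ : ℕ∞) V Ω) (v : E) :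
    ContDiffOn ℝ (⊤ : ℕ∞) (fun w => fderiv ℝ V w v) Ω :=
  (hV.fderiv_of_isOpen hΩ (by simp)).clm_apply contDiffOn_const

lemma ContDiffOn.differentiableAt_of_isOpen (hΩ : IsOpen Ω) (hV : ContDiffOn ℝ (⊤ : ℕ∞) V Ω)
    (hz : z ∈ Ω) : DifferentiableAt ℝ V z :=
  (hV.contDiffAt (hΩ.mem_nhds hz)).differentiableAt (by simp)

lemma hasDerivAt_along_line (hV : DifferentiableAt ℝ V z) (v : E) :
    HasDerivAt (fun s : ℝ => V (z + s • v)) (fderiv ℝ V z v) 0 := by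
  have h1 : HasDerivAt (fun s : ℝ => z + s • v) v 0 := by
    simpa using ((hasDerivAt_id (0 : ℝ)).smul_const v).const_add z
  have h2 : HasFDerivAt V (fderiv ℝ V z) (z + (0 : ℝ) • v) := by simpa using hV.hasFDerivAt
  exact h2.comp_hasDerivAt (0 : ℝ) h1

lemma eventually_hasDerivAt_along_line (hΩ : IsOpen Ω) (hV : ContDiffOn ℝ (⊤ : ℕ∞) V Ω)
    (hz : z ∈ Ω) (v : E) :
    ∀ᶠ s in 𝓝 (0 : ℝ),
      HasDerivAt (fun s : ℝ => V (z + s • v)) (fderiv ℝ V (z + s • v) v) s := by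
  have hc : Continuous fun s : ℝ => z + s • v := by fun_prop
  have : ∀ᶠ s in 𝓝 (0 : ℝ), z + s • v ∈ Ω :=
    hc.continuousAt.eventually_mem (hΩ.mem_nhds (by simpa using hz))
  filter_upwards [this] with s hs
  have h1 : HasDerivAt (fun s : ℝ => z + s • v) v s := by
    simpa using ((hasDerivAt_id s).smul_const v).const_add z
  exact (hV.differentiableAt_of_isOpen hΩ hs).hasFDerivAt.comp_hasDerivAt s h1

end Lines

section GradientEstimate

variable {n : ℕ}

/-- Reflection of spacetime in the hyperplane through `a` orthogonal to the `α`-th axis. -/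
def axisReflection (α : Fin n) (a : Sp n) (z : Sp n × ℝ) : Sp n × ℝ :=
  z + (-2 * (z.1 α - a α)) • sdir n α

lemma norm_add_smul_single_sq (y : Sp n) (α : Fin n) (s : ℝ) :
    ‖y + s • EuclideanSpace.single α (1 : ℝ)‖ ^ 2 = ‖y‖ ^ 2 + 2 * s * y α + s ^ 2 := by
  rw [norm_add_sq_real, norm_smul, inner_smul_right, EuclideanSpace.inner_single_right]
  simp
  ring

lemma axisReflection_mem_closedCyl {α : Fin n} {z w : Sp n × ℝ} {r : ℝ}
    (hw : w ∈ closedCyl z r) : axisReflection α z.1 w ∈ closedCyl z r := by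
  obtain ⟨h1, h2⟩ := hw
  refine ⟨?_, ?_⟩
  · rw [mem_closedBall, dist_eq_norm] at h1 ⊢
    have h3 : (axisReflection α z.1 w).1 - z.1
        = (w.1 - z.1) + (-2 * (w.1 α - z.1 α)) • EuclideanSpace.single α (1 : ℝ) := by
      simp [axisReflection, sdir]; abel
    have h4 := norm_add_smul_single_sq (w.1 - z.1) α (-2 * (w.1 α - z.1 α))
    rw [← h3] at h4
    have h5 : ‖(axisReflection α z.1 w).1 - z.1‖ ^ 2 = ‖w.1 - z.1‖ ^ 2 := by
      rw [h4]; simp; ring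
    have h6 := (sq_eq_sq₀ (norm_nonneg _) (norm_nonneg _)).1 h5
    rw [h6]; exact h1
  · simpa [axisReflection, sdir] using h2

lemma isCompact_closedCyl (z : Sp n × ℝ) (r : ℝ) : IsCompact (closedCyl z r) :=
  (isCompact_closedBall _ _).prod isCompact_Icc

/-- The barrier function for the gradient estimate. -/
def gradBarrier (α : Fin n) (z : Sp n × ℝ) (r S κ : ℝ) (w : Sp n × ℝ) : ℝ :=
  S / r ^ 2 * (‖w.1 - z.1‖ ^ 2 - (w.2 - z.2)) + κ * ((w.1 α - z.1 α) * (r - (w.1 α - z.1 α)))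

/-- Odd part of `g` under the axis reflection, minus the barrier. -/
def oddDefect (g : Sp n × ℝ → ℝ) (α : Fin n) (z : Sp n × ℝ) (r S κ : ℝ) (w : Sp n × ℝ) : ℝ :=
  (g w - g (axisReflection α z.1 w)) / 2 - gradBarrier α z r S κ w

lemma continuous_axisReflection (α : Fin n) (a : Sp n) : Continuous (axisReflection α a) := by
  unfold axisReflection; fun_prop

lemma continuous_gradBarrier (α : Fin n) (z : Sp n × ℝ) (r S κ : ℝ) :
    Continuous (gradBarrier α z r S κ) := by
  unfold gradBarrier; fun_prop

/-- Second derivative test in the `β`-th direction for `oddDefect`. -/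
lemma oddDefect_second_deriv {g : Sp n × ℝ → ℝ} {Ω : Set (Sp n × ℝ)} (hΩ : IsOpen Ω)
    (hg : ContDiffOn ℝ (⊤ : ℕ∞) g Ω) {α β : Fin n} {z w : Sp n × ℝ} {r S κ : ℝ}
    (hw : w ∈ Ω) (hw' : axisReflection α z.1 w ∈ Ω)
    (hmax : IsLocalMax (fun s : ℝ => oddDefect g α z r S κ (w + s • sdir n β)) 0) :
    (fderiv ℝ (fun w => fderiv ℝ g w (sdir n β)) w (sdir n β)
      - fderiv ℝ (fun w => fderiv ℝ g w (sdir n β)) (axisReflection α z.1 w) (sdir n β)) / 2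
      - 2 * (S / r ^ 2) + (if α = β then 2 * κ else 0) ≤ 0 := by
  set δ : ℝ := if α = β then 1 else 0 with hδ
  set y : Sp n := w.1 - z.1
  have hδ2 : (1 - 2 * δ) * (1 - 2 * δ) = 1 := by rw [hδ]; split_ifs <;> norm_num
  have hline : ∀ s : ℝ, axisReflection α z.1 (w + s • sdir n β)
      = axisReflection α z.1 w + s • ((1 - 2 * δ) • sdir n β) := by
    intro s
    have : (w + s • sdir n β).1 α = w.1 α + s * δ := by
      simp [sdir, hδ]
    simp only [axisReflection, this]
    by_cases hab : α = β
    · subst hab; simp only [hδ, if_true]; module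
    · simp only [hδ, if_neg hab]; module
  have hbar : ∀ s : ℝ, gradBarrier α z r S κ (w + s • sdir n β)
      = S / r ^ 2 * (‖y‖ ^ 2 + 2 * s * y β + s ^ 2 - (w.2 - z.2))
        + κ * ((y α + s * δ) * (r - (y α + s * δ))) := by
    intro s
    have h1 : (w + s • sdir n β).1 - z.1 = y + s • EuclideanSpace.single β (1 : ℝ) := by
      simp [sdir, y]; abel
    have h2 : (w + s • sdir n β).1 α - z.1 α = y α + s * δ := by
      simp [sdir, hδ, y]; ring
    have h3 : (w + s • sdir n β).2 = w.2 := by simp [sdir]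
    rw [gradBarrier, h1, h2, h3, norm_add_smul_single_sq]
  have e1 := eventually_hasDerivAt_along_line hΩ hg hw (sdir n β)
  have e2 := eventually_hasDerivAt_along_line hΩ hg hw' ((1 - 2 * δ) • sdir n β)
  have d1 := hasDerivAt_along_line
    ((hg.fderiv_apply_infty hΩ (sdir n β)).differentiableAt_of_isOpen hΩ hw) (sdir n β)
  have d2 := hasDerivAt_along_line
    ((hg.fderiv_apply_infty hΩ ((1 - 2 * δ) • sdir n β)).differentiableAt_of_isOpen hΩ hw')
      ((1 - 2 * δ) • sdir n β)
  have hD : fderiv ℝ (fun w => fderiv ℝ g w ((1 - 2 * δ) • sdir n β)) (axisReflection α z.1 w)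
      ((1 - 2 * δ) • sdir n β)
      = fderiv ℝ (fun w => fderiv ℝ g w (sdir n β)) (axisReflection α z.1 w) (sdir n β) := by
    have hdiff := (hg.fderiv_apply_infty hΩ (sdir n β)).differentiableAt_of_isOpen hΩ hw'
    have : (fun w => fderiv ℝ g w ((1 - 2 * δ) • sdir n β))
        = fun w => (1 - 2 * δ) * fderiv ℝ g w (sdir n β) := by
      funext w; simp
    rw [this, fderiv_const_mul hdiff, map_smul]
    simp only [_root_.smul_apply, smul_eq_mul]
    rw [← mul_assoc, hδ2, one_mul]
  rw [hD] at d2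
  have key := IsLocalMax.second_deriv_nonpos (h' := fun s =>
      (fderiv ℝ g (w + s • sdir n β) (sdir n β)
        - fderiv ℝ g (axisReflection α z.1 w + s • ((1 - 2 * δ) • sdir n β))
          ((1 - 2 * δ) • sdir n β)) / 2
      - (S / r ^ 2 * (2 * y β + 2 * s) + κ * (δ * (r - 2 * y α) - 2 * δ * δ * s)))
    (c := (fderiv ℝ (fun w => fderiv ℝ g w (sdir n β)) w (sdir n β)
      - fderiv ℝ (fun w => fderiv ℝ g w (sdir n β)) (axisReflection α z.1 w) (sdir n β)) / 2
      - (S / r ^ 2 * 2 + κ * (- 2 * δ * δ))) hmax ?_ ?_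
  · have : κ * (-2 * δ * δ) = -(if α = β then 2 * κ else 0) := by
      rw [hδ]; split_ifs <;> ring
    rw [this] at key
    linarith
  · filter_upwards [e1, e2] with s h1 h2
    have h3 : HasDerivAt (fun s : ℝ => S / r ^ 2 * (‖y‖ ^ 2 + 2 * s * y β + s ^ 2 - (w.2 - z.2))
        + κ * ((y α + s * δ) * (r - (y α + s * δ))))
        (S / r ^ 2 * (2 * y β + 2 * s) + κ * (δ * (r - 2 * y α) - 2 * δ * δ * s)) s := by
      have i := hasDerivAt_id s
      have a1 := ((((i.const_mul 2).mul_const (y β)).const_add (‖y‖ ^ 2)).add (i.pow 2)).sub_const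
        (w.2 - z.2)
      have a2 := (i.mul_const δ).const_add (y α)
      have a3 := (a1.const_mul (S / r ^ 2)).add ((a2.mul (a2.const_sub r)).const_mul κ)
      refine HasDerivAt.congr_deriv a3 ?_
      simp only [id_eq, Nat.cast_ofNat]; ring
    have h4 := ((h1.sub h2).div_const 2).sub h3
    refine h4.congr_of_eventuallyEq (Eventually.of_forall fun s => ?_)
    simp only [oddDefect, hline, hbar]
    rfl
  · have h3 : HasDerivAt (fun s : ℝ => S / r ^ 2 * (2 * y β + 2 * s)
        + κ * (δ * (r - 2 * y α) - 2 * δ * δ * s)) (S / r ^ 2 * 2 + κ * (- 2 * δ * δ)) 0 := by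
      have i := hasDerivAt_id (0 : ℝ)
      have a3 := (((i.const_mul 2).const_add (2 * y β)).const_mul (S / r ^ 2)).add
        (((i.const_mul (2 * δ * δ)).const_sub (δ * (r - 2 * y α))).const_mul κ)
      refine HasDerivAt.congr_deriv a3 ?_
      simp
    exact ((d1.sub d2).div_const 2).sub h3

lemma HasDerivAt.nonpos_of_eventually_le {h : ℝ → ℝ} {c : ℝ} (hd : HasDerivAt h c 0)
    (hle : ∀ᶠ s in 𝓝[>] (0 : ℝ), h s ≤ h 0) : c ≤ 0 := by
  have h1 : Tendsto (slope h 0) (𝓝[>] 0) (𝓝 c) := (hasDerivAt_iff_tendsto_slope.1 hd).mono_left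
    (nhdsWithin_mono (0 : ℝ) (fun s (hs : 0 < s) => ne_of_gt hs))
  refine le_of_tendsto h1 ?_
  filter_upwards [hle, self_mem_nhdsWithin] with s hs hs0
  have hs0' : 0 < s := hs0
  rw [slope_def_field]
  exact div_nonpos_of_nonpos_of_nonneg (by linarith) (by linarith)

/-- First derivative test, backwards in time, for `oddDefect`. -/
lemma oddDefect_time_deriv {g : Sp n × ℝ → ℝ} {Ω : Set (Sp n × ℝ)} (hΩ : IsOpen Ω)
    (hg : ContDiffOn ℝ (⊤ : ℕ∞) g Ω) {α : Fin n} {z w : Sp n × ℝ} {r S κ : ℝ}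
    (hw : w ∈ Ω) (hw' : axisReflection α z.1 w ∈ Ω)
    (hmax : ∀ᶠ s in 𝓝[>] (0 : ℝ),
      oddDefect g α z r S κ (w + s • (-tdir n)) ≤ oddDefect g α z r S κ w) :
    0 ≤ (fderiv ℝ g w (tdir n) - fderiv ℝ g (axisReflection α z.1 w) (tdir n)) / 2
      + S / r ^ 2 := by
  set v : Sp n × ℝ := -tdir n with hv
  have hline : ∀ s : ℝ, axisReflection α z.1 (w + s • v) = axisReflection α z.1 w + s • v := by
    intro s
    have : (w + s • v).1 α = w.1 α := by simp [v, tdir]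
    simp only [axisReflection, this]
    abel
  have hbar : ∀ s : ℝ, gradBarrier α z r S κ (w + s • v)
      = S / r ^ 2 * (s + (‖w.1 - z.1‖ ^ 2 - (w.2 - z.2)))
        + κ * ((w.1 α - z.1 α) * (r - (w.1 α - z.1 α))) := by
    intro s
    have h1 : (w + s • v).1 = w.1 := by simp [v, tdir]
    have h3 : (w + s • v).2 = w.2 - s := by simp [v, tdir]; ring
    rw [gradBarrier, h1, h3]
    ring
  have d1 := hasDerivAt_along_line (hg.differentiableAt_of_isOpen hΩ hw) v
  have d2 := hasDerivAt_along_line (hg.differentiableAt_of_isOpen hΩ hw') v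
  have h3 : HasDerivAt (fun s : ℝ => S / r ^ 2 * (s + (‖w.1 - z.1‖ ^ 2 - (w.2 - z.2)))
        + κ * ((w.1 α - z.1 α) * (r - (w.1 α - z.1 α)))) (S / r ^ 2) 0 := by
    simpa using (((hasDerivAt_id (0 : ℝ)).add_const
      (‖w.1 - z.1‖ ^ 2 - (w.2 - z.2))).const_mul (S / r ^ 2)).add_const
        (κ * ((w.1 α - z.1 α) * (r - (w.1 α - z.1 α))))
  have h4 := ((d1.sub d2).div_const 2).sub h3
  have h5 := h4.congr_of_eventuallyEq (f₁ := fun s : ℝ => oddDefect g α z r S κ (w + s • v))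
    (Eventually.of_forall fun s => by simp only [oddDefect, hline, hbar]; rfl)
  have := h5.nonpos_of_eventually_le (by simpa using hmax)
  simp only [hv, map_neg] at this
  linarith

lemma abs_coord_le_norm (y : Sp n) (α : Fin n) : |y α| ≤ ‖y‖ := by
  simpa using PiLp.norm_apply_le y α

lemma oddDefect_nonpos {g : Sp n × ℝ → ℝ} {Ω : Set (Sp n × ℝ)} (hΩ : IsOpen Ω)
    (hg : ContDiffOn ℝ (⊤ : ℕ∞) g Ω) (α : Fin n) {z : Sp n × ℝ} {r S N κ : ℝ} (hr : 0 < r)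
    (hsub : closedCyl z r ⊆ Ω) (hS : ∀ w ∈ closedCyl z r, |g w| ≤ S)
    (hN : ∀ w ∈ closedCyl z r, |fderiv ℝ g w (tdir n) - spatialLaplacian g w| ≤ N)
    (hκ : N + S * (2 * n + 1) / r ^ 2 < 2 * κ) :
    ∀ w ∈ closedCyl z r, z.1 α ≤ w.1 α → oddDefect g α z r S κ w ≤ 0 := by
  have hz : z ∈ closedCyl z r :=
    ⟨mem_closedBall_self hr.le, by constructor <;> nlinarith [sq_nonneg r]⟩
  have hS0 : 0 ≤ S := (abs_nonneg _).trans (hS z hz)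
  have hN0 : 0 ≤ N := (abs_nonneg _).trans (hN z hz)
  have hκ0 : 0 ≤ κ := by
    have : 0 ≤ S * (2 * n + 1) / r ^ 2 := by positivity
    linarith
  have hq0 : 0 ≤ S / r ^ 2 := by positivity
  set H : Set (Sp n × ℝ) := {w | z.1 α ≤ w.1 α} with hH
  have hHc : IsClosed H := isClosed_le (by fun_prop) (by fun_prop)
  have hK : IsCompact (closedCyl z r ∩ H) := (isCompact_closedCyl z r).inter_right hHc
  have hcont : ContinuousOn (oddDefect g α z r S κ) (closedCyl z r ∩ H) := by
    have hgc : ContinuousOn g (closedCyl z r) := hg.continuousOn.mono hsub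
    have h1 : ContinuousOn (fun w => g (axisReflection α z.1 w)) (closedCyl z r) :=
      hgc.comp (continuous_axisReflection α z.1).continuousOn
        fun w hw => axisReflection_mem_closedCyl hw
    exact (((hgc.sub h1).div_const 2).sub (continuous_gradBarrier α z r S κ).continuousOn).mono
      inter_subset_left
  obtain ⟨w, ⟨hwC, hwH⟩, hmax⟩ := hK.exists_isMaxOn ⟨z, hz, le_refl (z.1 α)⟩ hcont
  intro w' hw' hw'H
  refine (hmax ⟨hw', hw'H⟩).trans ?_
  by_contra! hpos
  set y : Sp n := w.1 - z.1 with hy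
  have hyα : y α = w.1 α - z.1 α := by simp [hy]
  have hσC := axisReflection_mem_closedCyl (α := α) hwC
  have hy0 : 0 ≤ y α := by rw [hyα]; exact sub_nonneg.2 hwH
  have hyr : ‖y‖ ≤ r := by have := hwC.1; rwa [mem_closedBall, dist_eq_norm] at this
  have hyr' : y α ≤ r := (le_abs_self _).trans ((abs_coord_le_norm y α).trans hyr)
  have ht1 : w.2 ≤ z.2 := hwC.2.2
  have ht2 : z.2 - r ^ 2 ≤ w.2 := hwC.2.1
  have hbar : gradBarrier α z r S κ w
      = S / r ^ 2 * (‖y‖ ^ 2 - (w.2 - z.2)) + κ * (y α * (r - y α)) := by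
    rw [gradBarrier, ← hyα]
  have hodd : (g w - g (axisReflection α z.1 w)) / 2 ≤ S := by
    have h1 := (abs_le.1 (hS w hwC)).2
    have h2 := (abs_le.1 (hS _ hσC)).1
    linarith
  have hκy : 0 ≤ κ * (y α * (r - y α)) := mul_nonneg hκ0 (mul_nonneg hy0 (by linarith))
  have hSr : S / r ^ 2 * r ^ 2 = S := by field_simp
  have hd : gradBarrier α z r S κ w < (g w - g (axisReflection α z.1 w)) / 2 := by
    have := hpos
    rw [oddDefect] at this
    linarith
  have hyα_pos : 0 < y α := by
    refine lt_of_le_of_ne hy0 fun h0 => ?_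
    have : axisReflection α z.1 w = w := by
      rw [axisReflection, ← hyα, ← h0]; simp
    rw [this, hbar] at hd
    have : 0 ≤ S / r ^ 2 * (‖y‖ ^ 2 - (w.2 - z.2)) :=
      mul_nonneg hq0 (by nlinarith [sq_nonneg ‖y‖])
    linarith
  have hy_lt : ‖y‖ < r := by
    refine lt_of_le_of_ne hyr fun h0 => ?_
    rw [hbar, h0] at hd
    have : S / r ^ 2 * r ^ 2 ≤ S / r ^ 2 * (r ^ 2 - (w.2 - z.2)) :=
      mul_le_mul_of_nonneg_left (by linarith) hq0
    linarith
  have ht_lt : z.2 - r ^ 2 < w.2 := by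
    refine lt_of_le_of_ne ht2 fun h0 => ?_
    rw [hbar, ← h0] at hd
    have : S / r ^ 2 * r ^ 2 ≤ S / r ^ 2 * (‖y‖ ^ 2 - (z.2 - r ^ 2 - z.2)) :=
      mul_le_mul_of_nonneg_left (by nlinarith [sq_nonneg ‖y‖]) hq0
    linarith
  have hO : IsOpen {v : Sp n × ℝ | dist v.1 z.1 < r ∧ z.1 α < v.1 α} :=
    (isOpen_lt (by fun_prop) (by fun_prop)).and (isOpen_lt (by fun_prop) (by fun_prop))
  have hwO : w ∈ {v : Sp n × ℝ | dist v.1 z.1 < r ∧ z.1 α < v.1 α} :=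
    ⟨by rw [dist_eq_norm]; exact hy_lt, by linarith⟩
  have hspace : ∀ β : Fin n,
      IsLocalMax (fun s : ℝ => oddDefect g α z r S κ (w + s • sdir n β)) 0 := by
    intro β
    have hc : Continuous fun s : ℝ => w + s • sdir n β := by fun_prop
    have hev : ∀ᶠ s in 𝓝 (0 : ℝ),
        w + s • sdir n β ∈ {v : Sp n × ℝ | dist v.1 z.1 < r ∧ z.1 α < v.1 α} :=
      hc.continuousAt.eventually_mem (hO.mem_nhds (by simpa using hwO))
    filter_upwards [hev] with s hs
    have h2 : (w + s • sdir n β).2 = w.2 := by simp [sdir]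
    have := hmax (a := w + s • sdir n β)
      ⟨⟨hs.1.le, by rw [h2]; exact hwC.2⟩, hs.2.le⟩
    simpa using this
  have htime : ∀ᶠ s in 𝓝[>] (0 : ℝ),
      oddDefect g α z r S κ (w + s • (-tdir n)) ≤ oddDefect g α z r S κ w := by
    have hev : ∀ᶠ s in 𝓝[>] (0 : ℝ), s ∈ Ioo 0 (w.2 - (z.2 - r ^ 2)) :=
      Ioo_mem_nhdsGT (by linarith)
    filter_upwards [hev] with s hs
    have h1 : (w + s • (-tdir n)).1 = w.1 := by simp [tdir]
    have h2 : (w + s • (-tdir n)).2 = w.2 - s := by simp [tdir]; ring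
    refine hmax (a := w + s • (-tdir n)) ⟨⟨by rw [h1]; exact hwC.1, ?_⟩, ?_⟩
    · rw [h2]; exact ⟨by linarith [hs.2], by linarith [hs.1]⟩
    · change z.1 α ≤ (w + s • (-tdir n)).1 α
      rw [h1]; exact hwH
  have kt := oddDefect_time_deriv hΩ hg (hsub hwC) (hsub hσC) htime
  have ks := Finset.sum_nonpos fun β (_ : β ∈ Finset.univ) =>
    oddDefect_second_deriv hΩ hg (hsub hwC) (hsub hσC) (hspace β)
  have hsum : ∑ β : Fin n, ((fderiv ℝ (fun w => fderiv ℝ g w (sdir n β)) w (sdir n β)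
      - fderiv ℝ (fun w => fderiv ℝ g w (sdir n β)) (axisReflection α z.1 w) (sdir n β)) / 2
      - 2 * (S / r ^ 2) + (if α = β then 2 * κ else 0))
      = (spatialLaplacian g w - spatialLaplacian g (axisReflection α z.1 w)) / 2
        - n * (2 * (S / r ^ 2)) + 2 * κ := by
    rw [Finset.sum_add_distrib, Finset.sum_sub_distrib, ← Finset.sum_div, Finset.sum_sub_distrib]
    simp [spatialLaplacian]
  rw [hsum] at ks
  have n1 := (abs_le.1 (hN w hwC)).2
  have n2 := (abs_le.1 (hN _ hσC)).1
  have : S * (2 * n + 1) / r ^ 2 = n * (2 * (S / r ^ 2)) + S / r ^ 2 := by ring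
  linarith

/-- Interior gradient estimate for the inhomogeneous heat equation, scalar case. -/
theorem fderiv_sdir_le {g : Sp n × ℝ → ℝ} {Ω : Set (Sp n × ℝ)} (hΩ : IsOpen Ω)
    (hg : ContDiffOn ℝ (⊤ : ℕ∞) g Ω) (α : Fin n) {z : Sp n × ℝ} {r S N : ℝ} (hr : 0 < r)
    (hsub : closedCyl z r ⊆ Ω) (hS : ∀ w ∈ closedCyl z r, |g w| ≤ S)
    (hN : ∀ w ∈ closedCyl z r, |fderiv ℝ g w (tdir n) - spatialLaplacian g w| ≤ N) :
    fderiv ℝ g z (sdir n α) ≤ N * r / 2 + S * (2 * n + 1) / (2 * r) := by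
  have hz : z ∈ closedCyl z r :=
    ⟨mem_closedBall_self hr.le, by constructor <;> nlinarith [sq_nonneg r]⟩
  have key : ∀ κ : ℝ, N + S * (2 * n + 1) / r ^ 2 < 2 * κ →
      fderiv ℝ g z (sdir n α) ≤ κ * r := by
    intro κ hκ
    have hle := oddDefect_nonpos hΩ hg α hr hsub hS hN hκ
    have hzd := hg.differentiableAt_of_isOpen hΩ (hsub hz)
    have d1 := hasDerivAt_along_line hzd (sdir n α)
    have d2 := hasDerivAt_along_line hzd (-sdir n α)
    have d3 : HasDerivAt (fun s : ℝ => S / r ^ 2 * s ^ 2 + κ * (s * (r - s))) (κ * r) 0 := by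
      have i := hasDerivAt_id (0 : ℝ)
      refine (((i.pow 2).const_mul (S / r ^ 2)).add
        ((i.mul (i.const_sub r)).const_mul κ)).congr_deriv ?_
      simp
    have d4 := ((d1.sub d2).div_const 2).sub d3
    have := d4.nonpos_of_eventually_le ?_
    · simp only [map_neg] at this
      linarith
    · filter_upwards [Ioo_mem_nhdsGT hr] with s hs
      have e1 : (z + s • sdir n α).1 - z.1 = s • EuclideanSpace.single α (1 : ℝ) := by
        simp [sdir]
      have e2 : (z + s • sdir n α).2 = z.2 := by simp [sdir]
      have e3 : (z + s • sdir n α).1 α - z.1 α = s := by simp [sdir]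
      have e4 : ‖(z + s • sdir n α).1 - z.1‖ = s := by
        rw [e1, norm_smul]; simp [abs_of_pos hs.1]
      have e5 : axisReflection α z.1 (z + s • sdir n α) = z + s • -sdir n α := by
        rw [axisReflection, e3]; module
      have hm : z + s • sdir n α ∈ closedCyl z r := by
        refine ⟨?_, by rw [e2]; exact hz.2⟩
        rw [mem_closedBall, dist_eq_norm, e4]; exact hs.2.le
      have h1 := hle _ hm (by linarith [hs.1])
      rw [oddDefect, e5, gradBarrier, e4, e2, e3, sub_self, sub_zero] at h1
      simpa using h1
  have hlim : ∀ η > 0, fderiv ℝ g z (sdir n α)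
      ≤ N * r / 2 + S * (2 * n + 1) / (2 * r) + η := by
    intro η hη
    have hη' : 0 < η / r := by positivity
    have := key ((N + S * (2 * n + 1) / r ^ 2) / 2 + η / r) (by linarith)
    refine this.trans (le_of_eq ?_)
    field_simp
  exact le_of_forall_pos_le_add hlim

end GradientEstimate

/-! ### Semilinear heat systems and their prolongation -/

section Operators

variable {n : ℕ} {E F : Type*} [NormedAddCommGroup E] [NormedSpace ℝ E] [NormedAddCommGroup F]
  [NormedSpace ℝ F] {V W : Sp n × ℝ → E} {Ω : Set (Sp n × ℝ)} {z : Sp n × ℝ}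

lemma fderiv_apply_comm (hΩ : IsOpen Ω) (hV : ContDiffOn ℝ (⊤ : ℕ∞) V Ω) (hz : z ∈ Ω)
    (a b : Sp n × ℝ) :
    fderiv ℝ (fun w => fderiv ℝ V w a) z b = fderiv ℝ (fun w => fderiv ℝ V w b) z a := by
  have hd : DifferentiableAt ℝ (fderiv ℝ V) z :=
    (hV.fderiv_of_isOpen hΩ (m := (⊤ : ℕ∞)) (by simp)).differentiableAt_of_isOpen hΩ hz
  have happ : ∀ a b : Sp n × ℝ,
      fderiv ℝ (fun w => fderiv ℝ V w a) z b = fderiv ℝ (fderiv ℝ V) z b a := by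
    intro a b
    rw [fderiv_clm_apply hd (differentiableAt_const a)]
    simp
  have hs : IsSymmSndFDerivAt ℝ V z :=
    (hV.contDiffAt (hΩ.mem_nhds hz)).isSymmSndFDerivAt
      (by simpa using (WithTop.coe_le_coe.2 le_top : ((2 : ℕ∞) : WithTop ℕ∞) ≤ ((⊤ : ℕ∞) : _)))
  rw [happ, happ, hs.eq]

lemma fderiv_clm_comp_apply (hΩ : IsOpen Ω) (hV : ContDiffOn ℝ (⊤ : ℕ∞) V Ω) (hz : z ∈ Ω)
    (L : E →L[ℝ] F) (v : Sp n × ℝ) :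
    fderiv ℝ (fun w => L (V w)) z v = L (fderiv ℝ V z v) := by
  have := L.hasFDerivAt.comp z (hV.differentiableAt_of_isOpen hΩ hz).hasFDerivAt
  change fderiv ℝ (L ∘ V) z v = _
  rw [this.fderiv]
  rfl

lemma fderiv_congr_of_isOpen (hΩ : IsOpen Ω) (h : ∀ w ∈ Ω, V w = W w) (hz : z ∈ Ω) :
    fderiv ℝ V z = fderiv ℝ W z :=
  Filter.EventuallyEq.fderiv_eq (by filter_upwards [hΩ.mem_nhds hz] with w hw using h w hw)

lemma spatialLaplacian_clm_comp (hΩ : IsOpen Ω) (hV : ContDiffOn ℝ (⊤ : ℕ∞) V Ω) (hz : z ∈ Ω)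
    (L : E →L[ℝ] F) :
    spatialLaplacian (fun w => L (V w)) z = L (spatialLaplacian V z) := by
  simp only [spatialLaplacian, map_sum]
  refine Finset.sum_congr rfl fun α _ => ?_
  rw [fderiv_congr_of_isOpen hΩ (fun w hw => fderiv_clm_comp_apply hΩ hV hw L (sdir n α)) hz,
    fderiv_clm_comp_apply hΩ (hV.fderiv_apply_infty hΩ _) hz]

lemma fderiv_spatialLaplacian (hΩ : IsOpen Ω) (hV : ContDiffOn ℝ (⊤ : ℕ∞) V Ω) (hz : z ∈ Ω)
    (v : Sp n × ℝ) :
    fderiv ℝ (spatialLaplacian V) z v = spatialLaplacian (fun w => fderiv ℝ V w v) z := by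
  have hsm : ∀ α : Fin n, ContDiffOn ℝ (⊤ : ℕ∞) (fun w => fderiv ℝ V w (sdir n α)) Ω :=
    fun α => hV.fderiv_apply_infty hΩ _
  have : spatialLaplacian V
      = fun w => ∑ α : Fin n, fderiv ℝ (fun w => fderiv ℝ V w (sdir n α)) w (sdir n α) := rfl
  rw [this, fderiv_fun_sum fun α _ =>
    ((hsm α).fderiv_apply_infty hΩ _).differentiableAt_of_isOpen hΩ hz]
  simp only [spatialLaplacian, _root_.sum_apply]
  refine Finset.sum_congr rfl fun α _ => ?_
  rw [fderiv_apply_comm hΩ (hsm α) hz]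
  rw [fderiv_congr_of_isOpen hΩ (fun w hw => fderiv_apply_comm hΩ hV hw _ _) hz]

lemma ContDiffOn.spatialFDeriv (hΩ : IsOpen Ω) (hV : ContDiffOn ℝ (⊤ : ℕ∞) V Ω) :
    ContDiffOn ℝ (⊤ : ℕ∞) (spatialFDeriv V) Ω :=
  (hV.fderiv_of_isOpen hΩ (by simp)).clm_comp contDiffOn_const

lemma ContDiffOn.spatialLaplacian (hΩ : IsOpen Ω) (hV : ContDiffOn ℝ (⊤ : ℕ∞) V Ω) :
    ContDiffOn ℝ (⊤ : ℕ∞) (spatialLaplacian V) Ω := by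
  unfold _root_.spatialLaplacian
  exact ContDiffOn.sum fun α _ => (hV.fderiv_apply_infty hΩ _).fderiv_apply_infty hΩ _

lemma spatialFDeriv_single (V : Sp n × ℝ → E) (z : Sp n × ℝ) (α : Fin n) :
    spatialFDeriv V z (EuclideanSpace.single α 1) = fderiv ℝ V z (sdir n α) := rfl

lemma opNorm_le_sum_single (T : Sp n →L[ℝ] E) :
    ‖T‖ ≤ ∑ α : Fin n, ‖T (EuclideanSpace.single α 1)‖ := by
  refine T.opNorm_le_bound (Finset.sum_nonneg fun _ _ => norm_nonneg _) fun x => ?_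
  have hx : x = ∑ α : Fin n, x α • EuclideanSpace.single α (1 : ℝ) := by
    ext i
    simp [Finset.sum_apply, Pi.single_apply]
  calc ‖T x‖ = ‖∑ α : Fin n, x α • T (EuclideanSpace.single α (1 : ℝ))‖ := by
        conv_lhs => rw [hx]
        rw [map_sum]; simp only [map_smul]
    _ ≤ ∑ α : Fin n, ‖x α • T (EuclideanSpace.single α (1 : ℝ))‖ := norm_sum_le _ _
    _ ≤ ∑ α : Fin n, ‖T (EuclideanSpace.single α (1 : ℝ))‖ * ‖x‖ := by
        refine Finset.sum_le_sum fun α _ => ?_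
        rw [norm_smul, mul_comm]
        exact mul_le_mul_of_nonneg_left (abs_coord_le_norm x α) (norm_nonneg _)
    _ = _ := by rw [Finset.sum_mul]

/-- Interior gradient estimate for the inhomogeneous heat equation. -/
theorem norm_spatialFDeriv_le (hΩ : IsOpen Ω) (hV : ContDiffOn ℝ (⊤ : ℕ∞) V Ω) {r S N : ℝ}
    (hr : 0 < r) (hsub : closedCyl z r ⊆ Ω) (hS : ∀ w ∈ closedCyl z r, ‖V w‖ ≤ S)
    (hN : ∀ w ∈ closedCyl z r, ‖fderiv ℝ V w (tdir n) - spatialLaplacian V w‖ ≤ N) :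
    ‖spatialFDeriv V z‖ ≤ n * (N * r / 2 + S * (2 * n + 1) / (2 * r)) := by
  refine (opNorm_le_sum_single _).trans ?_
  have : ∀ α : Fin n, ‖spatialFDeriv V z (EuclideanSpace.single α 1)‖
      ≤ N * r / 2 + S * (2 * n + 1) / (2 * r) := by
    intro α
    have hz : z ∈ closedCyl z r :=
      ⟨mem_closedBall_self hr.le, by constructor <;> nlinarith [sq_nonneg r]⟩
    obtain ⟨L, hL1, hL2⟩ := exists_dual_vector'' ℝ (fderiv ℝ V z (sdir n α))
    have hLle : ∀ x : E, |L x| ≤ ‖x‖ := fun x => by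
      have := L.le_of_opNorm_le hL1 x
      simpa using this
    have key := fderiv_sdir_le hΩ (g := fun w => L (V w)) (L.contDiff.comp_contDiffOn hV) α hr
      hsub (fun w hw => (hLle _).trans (hS w hw)) (N := N) (fun w hw => by
        rw [fderiv_clm_comp_apply hΩ hV (hsub hw), spatialLaplacian_clm_comp hΩ hV (hsub hw),
          ← map_sub]
        exact (hLle _).trans (hN w hw))
    rw [fderiv_clm_comp_apply hΩ hV (hsub hz), hL2] at key
    simpa [spatialFDeriv_single] using key
  calc _ ≤ ∑ _α : Fin n, (N * r / 2 + S * (2 * n + 1) / (2 * r)) :=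
        Finset.sum_le_sum fun α _ => this α
    _ = _ := by simp only [Finset.sum_const, Finset.card_univ, Fintype.card_fin, nsmul_eq_mul]

end Operators

section Systems

variable {n : ℕ} {E : Type*} [NormedAddCommGroup E] [NormedSpace ℝ E]

/-- `V` is a smooth solution of `∂ₜV = ΔV + F(V, ∇V)` on the open set `Ω`. -/
structure IsHeatSystemSol (F : E × (Sp n →L[ℝ] E) → E) (V : Sp n × ℝ → E)
    (Ω : Set (Sp n × ℝ)) : Prop where
  isOpen : IsOpen Ω
  smooth : ContDiffOn ℝ (⊤ : ℕ∞) V Ω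
  eqn : ∀ z ∈ Ω, fderiv ℝ V z (tdir n) = spatialLaplacian V z + F (V z, spatialFDeriv V z)

/-- The first prolongation `(V, ∇V)`. -/
def prolong (V : Sp n × ℝ → E) (z : Sp n × ℝ) : E × (Sp n →L[ℝ] E) := (V z, spatialFDeriv V z)

/-- The nonlinearity of the system solved by the first prolongation. -/
def prolongRHS (F : E × (Sp n →L[ℝ] E) → E)
    (x : (E × (Sp n →L[ℝ] E)) × (Sp n →L[ℝ] E × (Sp n →L[ℝ] E))) : E × (Sp n →L[ℝ] E) :=
  (F x.1, (fderiv ℝ F x.1).comp x.2)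

/-- At most linear growth in the gradient, locally uniformly in the first variable. -/
def LinearGrowth (F : E × (Sp n →L[ℝ] E) → E) : Prop :=
  ∀ K : ℝ, ∃ C : ℝ, 0 ≤ C ∧ ∀ v w, ‖v‖ ≤ K → ‖F (v, w)‖ ≤ C * (1 + ‖w‖)

lemma ContDiff.prolongRHS {F : E × (Sp n →L[ℝ] E) → E} (hF : ContDiff ℝ (⊤ : ℕ∞) F) :
    ContDiff ℝ (⊤ : ℕ∞) (prolongRHS F) :=
  (hF.comp contDiff_fst).prodMk
    (((hF.fderiv_right (m := (⊤ : ℕ∞)) (by simp)).comp contDiff_fst).clm_comp contDiff_snd)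

lemma linearGrowth_prolongRHS [FiniteDimensional ℝ E] {F : E × (Sp n →L[ℝ] E) → E}
    (hF : ContDiff ℝ (⊤ : ℕ∞) F) : LinearGrowth (prolongRHS F) := by
  intro K
  have : ProperSpace (E × (Sp n →L[ℝ] E)) := FiniteDimensional.proper ℝ _
  have hc : IsCompact (closedBall (0 : E × (Sp n →L[ℝ] E)) K) := isCompact_closedBall _ _
  obtain ⟨C₁, h1⟩ := hc.exists_bound_of_continuousOn (f := F) hF.continuous.continuousOn
  obtain ⟨C₂, h2⟩ := hc.exists_bound_of_continuousOn (f := fderiv ℝ F)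
    (hF.continuous_fderiv (by simp)).continuousOn
  refine ⟨max 0 (max C₁ C₂), le_max_left _ _, fun v w hv => ?_⟩
  have hv' : v ∈ closedBall (0 : E × (Sp n →L[ℝ] E)) K := by simpa using hv
  set C := max 0 (max C₁ C₂)
  have hC1 : C₁ ≤ C := (le_max_left _ _).trans (le_max_right _ _)
  have hC2 : C₂ ≤ C := (le_max_right _ _).trans (le_max_right _ _)
  have hC0 : 0 ≤ C := le_max_left _ _
  rw [prolongRHS, Prod.norm_def]
  refine max_le ?_ ?_
  · calc ‖F v‖ ≤ C := (h1 v hv').trans hC1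
      _ ≤ C * (1 + ‖w‖) := by nlinarith [norm_nonneg w]
  · calc ‖(fderiv ℝ F v).comp w‖ ≤ ‖fderiv ℝ F v‖ * ‖w‖ :=
          ContinuousLinearMap.opNorm_comp_le _ _
      _ ≤ C * ‖w‖ := mul_le_mul_of_nonneg_right ((h2 v hv').trans hC2) (norm_nonneg _)
      _ ≤ C * (1 + ‖w‖) := by nlinarith [norm_nonneg w]

lemma IsHeatSystemSol.prolong {F : E × (Sp n →L[ℝ] E) → E} (hF : ContDiff ℝ (⊤ : ℕ∞) F)
    {V : Sp n × ℝ → E} {Ω : Set (Sp n × ℝ)} (h : IsHeatSystemSol F V Ω) :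
    IsHeatSystemSol (prolongRHS F) (prolong V) Ω := by
  have hsm : ContDiffOn ℝ (⊤ : ℕ∞) (_root_.prolong V) Ω :=
    h.smooth.prodMk (h.smooth.spatialFDeriv h.isOpen)
  refine ⟨h.isOpen, hsm, fun z hz => ?_⟩
  have hΩ := h.isOpen
  refine Prod.ext ?_ (ContinuousLinearMap.ext fun ξ => ?_)
  · have e1 := fderiv_clm_comp_apply hΩ hsm hz (.fst ℝ E (Sp n →L[ℝ] E)) (tdir n)
    have e2 := spatialLaplacian_clm_comp hΩ hsm hz (.fst ℝ E (Sp n →L[ℝ] E))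
    calc _ = fderiv ℝ V z (tdir n) := e1.symm
      _ = spatialLaplacian V z + F (V z, spatialFDeriv V z) := h.eqn z hz
      _ = _ := by rw [Prod.fst_add]; exact congrArg (· + _) e2
  · set L : (E × (Sp n →L[ℝ] E)) →L[ℝ] E :=
      (ContinuousLinearMap.apply ℝ E ξ).comp (.snd ℝ E (Sp n →L[ℝ] E))
    have hLV : ∀ w, L (_root_.prolong V w) = fderiv ℝ V w (ξ, 0) := fun w => rfl
    have e1 := fderiv_clm_comp_apply hΩ hsm hz L (tdir n)
    have e2 := spatialLaplacian_clm_comp hΩ hsm hz L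
    simp only [hLV] at e1 e2
    have hFd : DifferentiableAt ℝ F (_root_.prolong V z) :=
      hF.contDiffAt.differentiableAt (by simp)
    have hPd := hsm.differentiableAt_of_isOpen hΩ hz
    have e3 : fderiv ℝ (fun w => F (_root_.prolong V w)) z (ξ, 0)
        = fderiv ℝ F (_root_.prolong V z) (fderiv ℝ (_root_.prolong V) z (ξ, 0)) := by
      have := hFd.hasFDerivAt.comp z hPd.hasFDerivAt
      change fderiv ℝ (F ∘ _root_.prolong V) z (ξ, 0) = _
      rw [this.fderiv]; rfl
    have hadd : fderiv ℝ (fun w => spatialLaplacian V w + F (_root_.prolong V w)) z (ξ, 0)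
        = fderiv ℝ (spatialLaplacian V) z (ξ, 0)
          + fderiv ℝ (fun w => F (_root_.prolong V w)) z (ξ, 0) := by
      rw [fderiv_fun_add ((h.smooth.spatialLaplacian hΩ).differentiableAt_of_isOpen hΩ hz)
        (g := fun w => F (_root_.prolong V w)) (hFd.comp z hPd)]
      rfl
    calc _ = fderiv ℝ (fun w => fderiv ℝ V w (ξ, 0)) z (tdir n) := e1.symm
      _ = fderiv ℝ (fun w => fderiv ℝ V w (tdir n)) z (ξ, 0) :=
        fderiv_apply_comm hΩ h.smooth hz _ _
      _ = fderiv ℝ (fun w => spatialLaplacian V w + F (_root_.prolong V w)) z (ξ, 0) := by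
        rw [fderiv_congr_of_isOpen hΩ h.eqn hz]; rfl
      _ = spatialLaplacian (fun w => fderiv ℝ V w (ξ, 0)) z
          + fderiv ℝ F (_root_.prolong V z) (fderiv ℝ (_root_.prolong V) z (ξ, 0)) := by
        rw [hadd, fderiv_spatialLaplacian hΩ h.smooth hz, e3]
      _ = _ := by rw [e2]; rfl

end Systems

/-! ### Point picking -/

section PointPicking

variable {n : ℕ}

/-- Parabolic distance to the parabolic boundary of `closedCyl z ρ`. -/
def cylDist (z : Sp n × ℝ) (ρ : ℝ) (w : Sp n × ℝ) : ℝ :=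
  min (ρ - dist w.1 z.1) (√(w.2 - (z.2 - ρ ^ 2)))

lemma mem_closedCyl_self (z : Sp n × ℝ) {r : ℝ} (hr : 0 ≤ r) : z ∈ closedCyl z r :=
  ⟨mem_closedBall_self hr, by constructor <;> nlinarith [sq_nonneg r]⟩

lemma closedCyl_subset {z w : Sp n × ℝ} {r ρ : ℝ} (h1 : dist w.1 z.1 + r ≤ ρ)
    (h2 : r ^ 2 + (z.2 - w.2) ≤ ρ ^ 2) (h3 : w.2 ≤ z.2) : closedCyl w r ⊆ closedCyl z ρ := by
  rintro v ⟨hv1, hv2, hv3⟩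
  rw [mem_closedBall] at hv1
  refine ⟨?_, by linarith, by linarith⟩
  rw [mem_closedBall]
  linarith [dist_triangle v.1 w.1 z.1]

lemma closedCyl_mono (z : Sp n × ℝ) {r ρ : ℝ} (h0 : 0 ≤ r) (h : r ≤ ρ) :
    closedCyl z r ⊆ closedCyl z ρ :=
  closedCyl_subset (by simpa using h) (by nlinarith) le_rfl

lemma closedCyl_half_subset {z w : Sp n × ℝ} {ρ : ℝ} (hρ : 0 ≤ ρ) (hw : w ∈ closedCyl z (ρ / 2)) :
    closedCyl w (ρ / 2) ⊆ closedCyl z ρ := by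
  obtain ⟨h1, h2, h3⟩ := hw
  rw [mem_closedBall] at h1
  exact closedCyl_subset (by linarith) (by nlinarith [hρ]) h3

/-- For a nonnegative continuous function on a compact parabolic cylinder, there is a subcylinder
on which the function is almost maximal at the top centre. -/
lemma exists_almost_max_subcylinder {z : Sp n × ℝ} {ρ : ℝ} (hρ : 0 ≤ ρ) {G : Sp n × ℝ → ℝ}
    (hG : ContinuousOn G (closedCyl z ρ)) (hG0 : ∀ w, 0 ≤ G w) :
    ∃ w ∈ closedCyl z ρ, ∃ d, 0 ≤ d ∧ d ≤ ρ ∧ closedCyl w d ⊆ closedCyl z ρ ∧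
      ρ * G z ≤ d * G w ∧ ∀ v ∈ closedCyl w (d / 2), d * G v ≤ 2 * (d * G w) := by
  have hcd : Continuous (cylDist z ρ) := by unfold cylDist; fun_prop
  obtain ⟨w, hw, hmax⟩ := (isCompact_closedCyl z ρ).exists_isMaxOn
    ⟨z, mem_closedCyl_self z hρ⟩ (hcd.continuousOn.mul hG)
  have hd0 : 0 ≤ cylDist z ρ w :=
    le_min (by have := hw.1; rw [mem_closedBall] at this; linarith) (Real.sqrt_nonneg _)
  have hd1 : cylDist z ρ w ≤ ρ - dist w.1 z.1 := min_le_left _ _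
  have hd2 : cylDist z ρ w ^ 2 ≤ w.2 - (z.2 - ρ ^ 2) := by
    have h1 : cylDist z ρ w ≤ √(w.2 - (z.2 - ρ ^ 2)) := min_le_right _ _
    have h2 := Real.sq_sqrt (show 0 ≤ w.2 - (z.2 - ρ ^ 2) by linarith [hw.2.1])
    nlinarith [Real.sqrt_nonneg (w.2 - (z.2 - ρ ^ 2))]
  have hsub : closedCyl w (cylDist z ρ w) ⊆ closedCyl z ρ :=
    closedCyl_subset (by linarith) (by linarith) hw.2.2
  refine ⟨w, hw, cylDist z ρ w, hd0, by linarith [dist_nonneg (x := w.1) (y := z.1)], hsub, ?_, ?_⟩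
  · have h1 : cylDist z ρ z = ρ := by
      simp [cylDist, Real.sqrt_sq hρ]
    have := hmax (a := z) (mem_closedCyl_self z hρ)
    simpa [h1] using this
  · intro v hv
    have hv' : v ∈ closedCyl z ρ := hsub (closedCyl_mono w (by linarith) (by linarith) hv)
    have h2 : cylDist z ρ w / 2 ≤ cylDist z ρ v := by
      obtain ⟨a1, a2, a3⟩ := hv
      rw [mem_closedBall] at a1
      refine le_min ?_ (Real.le_sqrt_of_sq_le ?_)
      · linarith [dist_triangle v.1 w.1 z.1]
      · nlinarith
    have h3 : cylDist z ρ v * G v ≤ cylDist z ρ w * G w := hmax hv'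
    nlinarith [hG0 v]

end PointPicking

/-! ### Interior regularity for semilinear heat systems -/

section Regularity

variable {n : ℕ} {E : Type*} [NormedAddCommGroup E] [NormedSpace ℝ E]

/-- Bounded solutions of semilinear heat systems have locally bounded gradient. -/
theorem exists_norm_spatialFDeriv_le {F : E × (Sp n →L[ℝ] E) → E} (hF : LinearGrowth F) {ρ : ℝ}
    (hρ : 0 < ρ) (K : ℝ) :
    ∃ C : ℝ, ∀ (V : Sp n × ℝ → E) (Ω : Set (Sp n × ℝ)) (z : Sp n × ℝ), IsHeatSystemSol F V Ω →
      closedCyl z ρ ⊆ Ω → (∀ w ∈ closedCyl z ρ, ‖V w‖ ≤ K) → ‖spatialFDeriv V z‖ ≤ C := by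
  obtain ⟨C₀, hC₀, hgrow⟩ := hF K
  set θ : ℝ := 1 / (2 * (1 + n * C₀ * ρ)) with hθ
  have hpos : 0 < 1 + n * C₀ * ρ := by positivity
  have hθ0 : 0 < θ := by positivity
  have hθ1 : θ ≤ 1 / 2 := by
    rw [hθ, div_le_div_iff₀ (by positivity) (by norm_num)]
    nlinarith [show 0 ≤ n * C₀ * ρ by positivity]
  have hθ2 : n * C₀ * ρ * θ ≤ 1 / 2 := by
    rw [hθ, mul_one_div, div_le_div_iff₀ (by positivity) (by norm_num)]
    linarith
  set B : ℝ := 2 * (n * (C₀ * θ * ρ ^ 2 / 2 + K * (2 * n + 1) / (2 * θ))) with hB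
  refine ⟨B / ρ, fun V Ω z hV hsub hK => ?_⟩
  have hK0 : 0 ≤ K := (norm_nonneg _).trans (hK z (mem_closedCyl_self z hρ.le))
  have hB0 : 0 ≤ B := by positivity
  obtain ⟨w, hw, d, hd0, hdρ, hwsub, hle, hhalf⟩ := exists_almost_max_subcylinder hρ.le
    (G := fun w => ‖spatialFDeriv V w‖)
    ((hV.smooth.spatialFDeriv hV.isOpen).continuousOn.mono hsub).norm fun _ => norm_nonneg _
  suffices hm : d * ‖spatialFDeriv V w‖ ≤ B by
    rw [le_div_iff₀ hρ, mul_comm]; exact hle.trans hm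
  rcases hd0.eq_or_lt with h0 | hd
  · rw [← h0, zero_mul]; exact hB0
  have hr : 0 < θ * d := by positivity
  have hsub1 : closedCyl w (θ * d) ⊆ closedCyl w (d / 2) :=
    closedCyl_mono w hr.le (by nlinarith)
  have hsub2 : closedCyl w (θ * d) ⊆ closedCyl z ρ :=
    (hsub1.trans (closedCyl_mono w (by linarith) (by linarith))).trans hwsub
  have key := norm_spatialFDeriv_le hV.isOpen hV.smooth hr (hsub2.trans hsub)
    (fun v hv => hK v (hsub2 hv)) (N := C₀ * (1 + 2 * ‖spatialFDeriv V w‖)) fun v hv => by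
      rw [hV.eqn v (hsub (hsub2 hv)), add_sub_cancel_left]
      have h1 : ‖spatialFDeriv V v‖ ≤ 2 * ‖spatialFDeriv V w‖ := by
        have := hhalf v (hsub1 hv)
        refine le_of_mul_le_mul_left ?_ hd
        linarith
      exact (hgrow _ _ (hK v (hsub2 hv))).trans (mul_le_mul_of_nonneg_left (by linarith) hC₀)
  set g : ℝ := ‖spatialFDeriv V w‖
  have h2 := mul_le_mul_of_nonneg_left key hd0
  have h3 : d * (n * (C₀ * (1 + 2 * g) * (θ * d) / 2 + K * (2 * n + 1) / (2 * (θ * d))))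
      = n * (C₀ * θ * d ^ 2 / 2 + K * (2 * n + 1) / (2 * θ)) + (n * C₀ * d * θ) * (d * g) := by
    field_simp; ring
  rw [h3] at h2
  have hdg : 0 ≤ d * g := mul_nonneg hd0 (norm_nonneg _)
  have h4 : (n * C₀ * d * θ) * (d * g) ≤ 1 / 2 * (d * g) := by
    refine mul_le_mul_of_nonneg_right (le_trans ?_ hθ2) hdg
    gcongr
  have h5 : n * (C₀ * θ * d ^ 2 / 2 + K * (2 * n + 1) / (2 * θ))
      ≤ n * (C₀ * θ * ρ ^ 2 / 2 + K * (2 * n + 1) / (2 * θ)) := by gcongr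
  linarith

end Regularity

/-! ### Higher derivatives of solutions of heat systems -/

section HigherRegularity

variable {n : ℕ}

/-- The derivative of a time slice is the spatial differential. -/
lemma fderiv_slice {E : Type*} [NormedAddCommGroup E] [NormedSpace ℝ E] {V : Sp n × ℝ → E}
    {z : Sp n × ℝ} (hV : DifferentiableAt ℝ V z) :
    fderiv ℝ (fun x => V (x, z.2)) z.1 = spatialFDeriv V z := by
  have h1 : HasFDerivAt (fun x : Sp n => (x, z.2)) (.inl ℝ (Sp n) ℝ) z.1 :=
    hasFDerivAt_prodMk_left _ _
  exact (HasFDerivAt.comp z.1 (g := V) hV.hasFDerivAt h1).fderiv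

lemma fderiv_slice_eventuallyEq {E : Type*} [NormedAddCommGroup E] [NormedSpace ℝ E]
    {V : Sp n × ℝ → E} {Ω : Set (Sp n × ℝ)} (hΩ : IsOpen Ω) (hV : ContDiffOn ℝ (⊤ : ℕ∞) V Ω)
    {z : Sp n × ℝ} (hz : z ∈ Ω) :
    fderiv ℝ (fun x => V (x, z.2)) =ᶠ[𝓝 z.1] fun x => (prolong V (x, z.2)).2 := by
  have hc : ContinuousAt (fun x : Sp n => (x, z.2)) z.1 := by fun_prop
  filter_upwards [hc.eventually_mem (hΩ.mem_nhds hz)] with x hx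
  exact fderiv_slice (z := (x, z.2)) (hV.differentiableAt_of_isOpen hΩ hx)

/-- Solutions with bounded first prolongation have locally bounded spatial derivatives of every
order. -/
theorem exists_norm_iteratedFDeriv_le (m : ℕ) {E : Type*} [NormedAddCommGroup E]
    [NormedSpace ℝ E] [FiniteDimensional ℝ E] {F : E × (Sp n →L[ℝ] E) → E}
    (hF : ContDiff ℝ (⊤ : ℕ∞) F) {ρ : ℝ} (hρ : 0 < ρ) (K : ℝ) :
    ∃ C : ℝ, ∀ (V : Sp n × ℝ → E) (Ω : Set (Sp n × ℝ)) (z : Sp n × ℝ), IsHeatSystemSol F V Ω →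
      closedCyl z ρ ⊆ Ω → (∀ w ∈ closedCyl z ρ, ‖prolong V w‖ ≤ K) →
        ‖iteratedFDeriv ℝ m (fun x => V (x, z.2)) z.1‖ ≤ C := by
  induction m generalizing E ρ K with
  | zero =>
    refine ⟨K, fun V Ω z _ _ hK => ?_⟩
    rw [norm_iteratedFDeriv_zero]
    exact (norm_fst_le (prolong V z)).trans (hK z (mem_closedCyl_self z hρ.le))
  | succ m ih =>
    have hρ2 : 0 < ρ / 2 := by positivity
    obtain ⟨C₁, hC₁⟩ := exists_norm_spatialFDeriv_le (linearGrowth_prolongRHS hF) hρ2 K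
    obtain ⟨C₂, hC₂⟩ := ih hF.prolongRHS hρ2 (max K C₁)
    refine ⟨‖ContinuousLinearMap.snd ℝ E (Sp n →L[ℝ] E)‖ * C₂, fun V Ω z hV hsub hK => ?_⟩
    have hP := hV.prolong hF
    have hz : z ∈ Ω := hsub (mem_closedCyl_self z hρ.le)
    have hbd : ∀ w ∈ closedCyl z (ρ / 2), ‖prolong (prolong V) w‖ ≤ max K C₁ := by
      intro w hw
      have hw' := closedCyl_half_subset hρ.le hw
      refine max_le_max (hK w (hw' (mem_closedCyl_self w hρ2.le))) ?_
      exact hC₁ _ Ω w hP (hw'.trans hsub) fun v hv => hK v (hw' hv)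
    have hfin := hC₂ (prolong V) Ω z hP
      ((closedCyl_mono z hρ2.le (by linarith)).trans hsub) hbd
    rw [← norm_iteratedFDeriv_fderiv,
      ((fderiv_slice_eventuallyEq hV.isOpen hV.smooth hz).iteratedFDeriv ℝ m).eq_of_nhds]
    have hc : ContDiffAt ℝ m (fun x => prolong V (x, z.2)) z.1 := by
      have h1 : ContDiffAt ℝ m (prolong V) z :=
        (hP.smooth.contDiffAt (hP.isOpen.mem_nhds hz)).of_le (by exact_mod_cast le_top)
      exact ContDiffAt.comp (g := prolong V) z.1 h1 (contDiffAt_id.prodMk contDiffAt_const)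
    exact ((ContinuousLinearMap.snd ℝ E (Sp n →L[ℝ] E)).norm_iteratedFDeriv_comp_left hc
      le_rfl).trans (mul_le_mul_of_nonneg_left hfin (norm_nonneg _))

variable {E : Type*} [NormedAddCommGroup E] [NormedSpace ℝ E]

lemma norm_spatialLaplacian_le {V : Sp n × ℝ → E} {Ω : Set (Sp n × ℝ)} (hΩ : IsOpen Ω)
    (hV : ContDiffOn ℝ (⊤ : ℕ∞) V Ω) {z : Sp n × ℝ} (hz : z ∈ Ω) :
    ‖spatialLaplacian V z‖ ≤ n * ‖spatialFDeriv (prolong V) z‖ := by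
  refine (norm_sum_le _ _).trans ?_
  have hP : ContDiffOn ℝ (⊤ : ℕ∞) (prolong V) Ω := hV.prodMk (hV.spatialFDeriv hΩ)
  have : ∀ α ∈ Finset.univ, ‖fderiv ℝ (fun w => fderiv ℝ V w (sdir n α)) z (sdir n α)‖
      ≤ ‖spatialFDeriv (prolong V) z‖ := by
    intro α _
    set e : Sp n := EuclideanSpace.single α 1
    have he : ‖e‖ = 1 := by simp [e]
    set L : (E × (Sp n →L[ℝ] E)) →L[ℝ] E :=
      (ContinuousLinearMap.apply ℝ E e).comp (.snd ℝ E (Sp n →L[ℝ] E))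
    have h1 : fderiv ℝ (fun w => fderiv ℝ V w (sdir n α)) z (sdir n α)
        = (spatialFDeriv (prolong V) z e).2 e := fderiv_clm_comp_apply hΩ hP hz L (sdir n α)
    rw [h1]
    calc ‖(spatialFDeriv (prolong V) z e).2 e‖ ≤ ‖(spatialFDeriv (prolong V) z e).2‖ * ‖e‖ :=
          ContinuousLinearMap.le_opNorm _ _
      _ ≤ ‖spatialFDeriv (prolong V) z e‖ := by rw [he, mul_one]; exact norm_snd_le _
      _ ≤ ‖spatialFDeriv (prolong V) z‖ * ‖e‖ := ContinuousLinearMap.le_opNorm _ _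
      _ = _ := by rw [he, mul_one]
  simpa using Finset.sum_le_sum this

lemma norm_fderiv_le_spatial_add_time (V : Sp n × ℝ → E) (z : Sp n × ℝ) :
    ‖fderiv ℝ V z‖ ≤ ‖spatialFDeriv V z‖ + ‖fderiv ℝ V z (tdir n)‖ := by
  refine ContinuousLinearMap.opNorm_le_bound _ (by positivity) fun v => ?_
  have hv : v = (v.1, 0) + v.2 • tdir n := by ext <;> simp [tdir]
  have h1 : fderiv ℝ V z v = spatialFDeriv V z v.1 + v.2 • fderiv ℝ V z (tdir n) := by
    conv_lhs => rw [hv]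
    rw [map_add, map_smul]; rfl
  rw [h1, add_mul]
  refine (norm_add_le _ _).trans (add_le_add ?_ ?_)
  · exact ((spatialFDeriv V z).le_opNorm _).trans
      (mul_le_mul_of_nonneg_left (norm_fst_le v) (norm_nonneg _))
  · rw [norm_smul, mul_comm]
    exact mul_le_mul_of_nonneg_left (norm_snd_le v) (norm_nonneg _)

lemma convex_closedCyl (z : Sp n × ℝ) (r : ℝ) : Convex ℝ (closedCyl z r) :=
  (convex_closedBall _ _).prod (convex_Icc _ _)

/-- Bounded solutions of smooth heat systems are locally Lipschitz in spacetime. -/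
theorem exists_norm_sub_le [FiniteDimensional ℝ E] {F : E × (Sp n →L[ℝ] E) → E}
    (hF : ContDiff ℝ (⊤ : ℕ∞) F) (hG : LinearGrowth F) {ρ : ℝ} (hρ : 0 < ρ) (K : ℝ) :
    ∃ C : ℝ, 0 ≤ C ∧ ∀ (V : Sp n × ℝ → E) (Ω : Set (Sp n × ℝ)) (z : Sp n × ℝ),
      IsHeatSystemSol F V Ω → closedCyl z ρ ⊆ Ω → (∀ w ∈ closedCyl z ρ, ‖V w‖ ≤ K) →
        ∀ w ∈ closedCyl z (ρ / 2), ‖V w - V z‖ ≤ C * ‖w - z‖ := by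
  have hρ2 : 0 < ρ / 2 := by positivity
  have hρ4 : 0 < ρ / 2 / 2 := by positivity
  obtain ⟨C₁, h1⟩ := exists_norm_spatialFDeriv_le hG hρ4 K
  obtain ⟨C₂, h2⟩ := exists_norm_spatialFDeriv_le (linearGrowth_prolongRHS hF) hρ4 (max K C₁)
  obtain ⟨C₃, h30, h3⟩ := hG K
  have key : ∀ (V : Sp n × ℝ → E) (Ω : Set (Sp n × ℝ)) (z : Sp n × ℝ),
      IsHeatSystemSol F V Ω → closedCyl z (ρ / 2) ⊆ Ω → (∀ w ∈ closedCyl z (ρ / 2), ‖V w‖ ≤ K) →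
        ‖fderiv ℝ V z‖ ≤ C₁ + (n * C₂ + C₃ * (1 + C₁)) := by
    intro V Ω z hV hsub hK
    have hz := hsub (mem_closedCyl_self z hρ2.le)
    have hgrad : ∀ w ∈ closedCyl z (ρ / 2 / 2), ‖spatialFDeriv V w‖ ≤ C₁ := by
      intro w hw
      have hw' := closedCyl_half_subset hρ2.le hw
      exact h1 V Ω w hV (hw'.trans hsub) fun v hv => hK v (hw' hv)
    have hmono : closedCyl z (ρ / 2 / 2) ⊆ closedCyl z (ρ / 2) :=
      closedCyl_mono z hρ4.le (by linarith)
    have hgz := hgrad z (mem_closedCyl_self z hρ4.le)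
    have hP := h2 (prolong V) Ω z (hV.prolong hF) (hmono.trans hsub) fun w hw =>
      max_le_max (hK w (hmono hw)) (hgrad w hw)
    refine (norm_fderiv_le_spatial_add_time V z).trans (add_le_add hgz ?_)
    rw [hV.eqn z hz]
    refine (norm_add_le _ _).trans (add_le_add ?_ ?_)
    · exact (norm_spatialLaplacian_le hV.isOpen hV.smooth hz).trans
        (mul_le_mul_of_nonneg_left hP n.cast_nonneg)
    · exact (h3 _ _ (hK z (mem_closedCyl_self z hρ2.le))).trans
        (mul_le_mul_of_nonneg_left (by linarith) h30)
  refine ⟨max 0 (C₁ + (n * C₂ + C₃ * (1 + C₁))), le_max_left _ _,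
    fun V Ω z hV hsub hK w hw => ?_⟩
  have hmono : closedCyl z (ρ / 2) ⊆ closedCyl z ρ := closedCyl_mono z hρ2.le (by linarith)
  refine (convex_closedCyl z (ρ / 2)).norm_image_sub_le_of_norm_fderiv_le (𝕜 := ℝ)
    (fun v hv => hV.smooth.differentiableAt_of_isOpen hV.isOpen (hsub (hmono hv)))
    (fun v hv => ?_) (mem_closedCyl_self z hρ2.le) hw
  have hv' := closedCyl_half_subset hρ.le hv
  exact (key V Ω v hV (hv'.trans hsub) fun y hy => hK y (hv' hy)).trans (le_max_right _ _)

end HigherRegularity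

/-! ### The harmonic map heat flow as a heat system -/

section Sphere

variable {n k : ℕ}

/-- The nonlinearity `|∇u|² u` of the harmonic map heat flow into the sphere. -/
def sphereRHS (n k : ℕ) (x : (Fin k → ℝ) × (Sp n →L[ℝ] (Fin k → ℝ))) : Fin k → ℝ :=
  (∑ α : Fin n, ∑ i : Fin k, (x.2 (EuclideanSpace.single α 1) i) ^ 2) • x.1

lemma contDiff_sphereRHS : ContDiff ℝ (⊤ : ℕ∞) (sphereRHS n k) := by
  refine ContDiff.smul (f := fun x : (Fin k → ℝ) × (Sp n →L[ℝ] (Fin k → ℝ)) =>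
    ∑ α : Fin n, ∑ i : Fin k, (x.2 (EuclideanSpace.single α 1) i) ^ 2)
    (ContDiff.sum fun α _ => ContDiff.sum fun i _ => ContDiff.pow ?_ 2) contDiff_fst
  exact ((ContinuousLinearMap.proj (R := ℝ) (φ := fun _ : Fin k => ℝ) i).comp
    (ContinuousLinearMap.apply ℝ (Fin k → ℝ) (EuclideanSpace.single α (1 : ℝ)))).contDiff.comp
      contDiff_snd

lemma sphereRHS_smul (v : Fin k → ℝ) (r : ℝ) (T : Sp n →L[ℝ] (Fin k → ℝ)) :
    sphereRHS n k (v, r • T) = r ^ 2 • sphereRHS n k (v, T) := by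
  simp only [sphereRHS, smul_smul, Finset.mul_sum]
  congr 1
  refine Finset.sum_congr rfl fun α _ => Finset.sum_congr rfl fun i _ => ?_
  simp [mul_pow]

variable {u : Sp n × ℝ → Fin k → ℝ} {Ω : Set (Sp n × ℝ)} {z : Sp n × ℝ}

lemma pd_eq_fderiv_apply (hΩ : IsOpen Ω) (hu : ContDiffOn ℝ (⊤ : ℕ∞) u Ω) (hz : z ∈ Ω) (i : Fin k)
    (v : Sp n × ℝ) : pd u i v z = fderiv ℝ u z v i :=
  fderiv_clm_comp_apply hΩ hu hz (ContinuousLinearMap.proj (R := ℝ) (φ := fun _ : Fin k => ℝ) i) v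

lemma gradSq_eq_sum (hΩ : IsOpen Ω) (hu : ContDiffOn ℝ (⊤ : ℕ∞) u Ω) (hz : z ∈ Ω) :
    gradSq u z = ∑ α : Fin n, ∑ i : Fin k,
      (spatialFDeriv u z (EuclideanSpace.single α 1) i) ^ 2 := by
  simp only [gradSq, pd_eq_fderiv_apply hΩ hu hz, spatialFDeriv_single]

lemma norm_spatialFDeriv_le_sqrt_gradSq (hΩ : IsOpen Ω) (hu : ContDiffOn ℝ (⊤ : ℕ∞) u Ω)
    (hz : z ∈ Ω) : ‖spatialFDeriv u z‖ ≤ n * √(gradSq u z) := by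
  refine (opNorm_le_sum_single _).trans ?_
  rw [gradSq_eq_sum hΩ hu hz]
  set T := spatialFDeriv u z
  have : ∀ α ∈ Finset.univ, ‖T (EuclideanSpace.single α 1)‖
      ≤ √(∑ α : Fin n, ∑ i : Fin k, (T (EuclideanSpace.single α 1) i) ^ 2) := by
    intro α _
    refine (pi_norm_le_iff_of_nonneg (Real.sqrt_nonneg _)).2 fun i => Real.abs_le_sqrt ?_
    refine le_trans ?_ (Finset.single_le_sum (f := fun α => ∑ i : Fin k,
      (T (EuclideanSpace.single α 1) i) ^ 2) (fun _ _ => Finset.sum_nonneg fun i _ => sq_nonneg _)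
      (Finset.mem_univ α))
    exact Finset.single_le_sum (f := fun i => (T (EuclideanSpace.single α 1) i) ^ 2)
      (fun i _ => sq_nonneg _) (Finset.mem_univ i)
  simpa using Finset.sum_le_sum this

lemma continuousOn_gradSq (hΩ : IsOpen Ω) (hu : ContDiffOn ℝ (⊤ : ℕ∞) u Ω) :
    ContinuousOn (gradSq u) Ω :=
  continuousOn_finsetSum _ fun _ _ => continuousOn_finsetSum _ fun i _ =>
    (((contDiffOn_pi.1 hu i).fderiv_apply_infty hΩ _).continuousOn.pow 2)

lemma HeatFlow.isHeatSystemSol (hΩ : IsOpen Ω) (hu : ContDiffOn ℝ (⊤ : ℕ∞) u Ω)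
    (h : HeatFlow u Ω) : IsHeatSystemSol (sphereRHS n k) u Ω := by
  refine ⟨hΩ, hu, fun z hz => funext fun i => ?_⟩
  have h2 : lap u i z = spatialLaplacian u z i := spatialLaplacian_clm_comp hΩ hu hz
    (ContinuousLinearMap.proj (R := ℝ) (φ := fun _ : Fin k => ℝ) i)
  have := h z hz i
  rw [pd_eq_fderiv_apply hΩ hu hz, h2, gradSq_eq_sum hΩ hu hz] at this
  exact this

lemma SphereValued.norm_le_one {D : Set (Sp n × ℝ)} (h : SphereValued u D) (hz : z ∈ D) :
    ‖u z‖ ≤ 1 := by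
  refine (pi_norm_le_iff_of_nonneg zero_le_one).2 fun i => ?_
  rw [Real.norm_eq_abs, ← sq_le_one_iff_abs_le_one, ← h z hz]
  exact Finset.single_le_sum (f := fun i => u z i ^ 2) (fun i _ => sq_nonneg _) (Finset.mem_univ i)

end Sphere

/-! ### Parabolic rescaling -/

section Rescale

variable {n : ℕ} {E : Type*} [NormedAddCommGroup E] [NormedSpace ℝ E]

/-- The parabolic dilation by `r` centred at `w`. -/
def paraDil (w : Sp n × ℝ) (r : ℝ) (v : Sp n × ℝ) : Sp n × ℝ :=
  (w.1 + r • v.1, w.2 + r ^ 2 * v.2)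

lemma paraDil_zero (w : Sp n × ℝ) (r : ℝ) : paraDil w r 0 = w := by simp [paraDil]

lemma continuous_paraDil (w : Sp n × ℝ) (r : ℝ) : Continuous (paraDil w r) := by
  unfold paraDil; fun_prop

lemma hasFDerivAt_paraDil (w : Sp n × ℝ) (r : ℝ) (v : Sp n × ℝ) :
    HasFDerivAt (paraDil w r)
      ((r • ContinuousLinearMap.id ℝ (Sp n)).prodMap (r ^ 2 • ContinuousLinearMap.id ℝ ℝ)) v :=
  (((r • ContinuousLinearMap.id ℝ (Sp n)).hasFDerivAt.const_add w.1).comp v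
    hasFDerivAt_fst).prodMk
    (((r ^ 2 • ContinuousLinearMap.id ℝ ℝ).hasFDerivAt.const_add w.2).comp v hasFDerivAt_snd)

lemma paraDil_mem_closedCyl {w v z : Sp n × ℝ} {r s : ℝ} (hr : 0 ≤ r)
    (hv : v ∈ closedCyl z s) : paraDil w r v ∈ closedCyl (paraDil w r z) (r * s) := by
  obtain ⟨h1, h2, h3⟩ := hv
  rw [mem_closedBall, dist_eq_norm] at h1
  refine ⟨?_, ?_, ?_⟩
  · simp only [paraDil, mem_closedBall, dist_add_left]
    rw [dist_eq_norm, ← smul_sub, norm_smul, Real.norm_of_nonneg hr]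
    gcongr
  · simp only [paraDil]; nlinarith [sq_nonneg r]
  · simp only [paraDil]; nlinarith [sq_nonneg r]

lemma exists_paraDil_eq {w v : Sp n × ℝ} {r s : ℝ} (hr : 0 < r)
    (hv : v ∈ closedCyl w (r * s)) : ∃ y ∈ closedCyl (0 : Sp n × ℝ) s, paraDil w r y = v := by
  have hr' : r⁻¹ * r = 1 := inv_mul_cancel₀ hr.ne'
  refine ⟨paraDil (-(r⁻¹ • w.1), -(r⁻¹ ^ 2 * w.2)) r⁻¹ v, ?_, ?_⟩
  · have h1 := paraDil_mem_closedCyl (w := (-(r⁻¹ • w.1), -(r⁻¹ ^ 2 * w.2)))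
      (inv_nonneg.2 hr.le) hv
    rw [← mul_assoc, hr', one_mul] at h1
    convert h1 using 1
    simp [paraDil, Prod.zero_eq_mk]
  · simp only [paraDil, Prod.ext_iff]
    constructor
    · rw [smul_add, smul_neg, smul_smul, smul_smul, mul_inv_cancel₀ hr.ne']; simp
    · field_simp; ring

variable {V : Sp n × ℝ → E} {Ω : Set (Sp n × ℝ)}

lemma fderiv_comp_paraDil {w v : Sp n × ℝ} {r : ℝ} (hV : DifferentiableAt ℝ V (paraDil w r v))
    (h : Sp n × ℝ) : fderiv ℝ (V ∘ paraDil w r) v h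
      = fderiv ℝ V (paraDil w r v) (r • h.1, r ^ 2 * h.2) := by
  rw [(hV.hasFDerivAt.comp v (hasFDerivAt_paraDil w r v)).fderiv]
  rfl

lemma spatialFDeriv_comp_paraDil {w v : Sp n × ℝ} {r : ℝ}
    (hV : DifferentiableAt ℝ V (paraDil w r v)) :
    spatialFDeriv (V ∘ paraDil w r) v = r • spatialFDeriv V (paraDil w r v) := by
  ext1 ξ
  simp only [spatialFDeriv, ContinuousLinearMap.comp_apply, _root_.smul_apply,
    fderiv_comp_paraDil hV, ← map_smul]
  simp

lemma fderiv_comp_paraDil_sdir {w v : Sp n × ℝ} {r : ℝ}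
    (hV : DifferentiableAt ℝ V (paraDil w r v)) (α : Fin n) :
    fderiv ℝ (V ∘ paraDil w r) v (sdir n α) = r • fderiv ℝ V (paraDil w r v) (sdir n α) := by
  have := congrArg (fun T => T (EuclideanSpace.single α (1 : ℝ))) (spatialFDeriv_comp_paraDil hV)
  simpa only [_root_.smul_apply, spatialFDeriv_single] using this

lemma spatialLaplacian_comp_paraDil (hΩ : IsOpen Ω) (hV : ContDiffOn ℝ (⊤ : ℕ∞) V Ω)
    {w v : Sp n × ℝ} {r : ℝ} (hv : paraDil w r v ∈ Ω) :
    spatialLaplacian (V ∘ paraDil w r) v = r ^ 2 • spatialLaplacian V (paraDil w r v) := by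
  simp only [spatialLaplacian, Finset.smul_sum]
  refine Finset.sum_congr rfl fun α _ => ?_
  have hd := (hV.fderiv_apply_infty hΩ (sdir n α)).differentiableAt_of_isOpen hΩ hv
  rw [fderiv_congr_of_isOpen (hΩ.preimage (continuous_paraDil w r)) (z := v)
    (fun y hy => fderiv_comp_paraDil_sdir (hV.differentiableAt_of_isOpen hΩ hy) α) hv]
  have h2 := fderiv_comp_paraDil_sdir (V := fun y => fderiv ℝ V y (sdir n α)) hd α
  have h3 : DifferentiableAt ℝ ((fun y => fderiv ℝ V y (sdir n α)) ∘ paraDil w r) v :=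
    hd.comp v (hasFDerivAt_paraDil w r v).differentiableAt
  have h4 := fderiv_fun_const_smul h3 r
  rw [Function.comp_def] at h2 h4
  rw [h4, _root_.smul_apply, h2, smul_smul, sq]

lemma IsHeatSystemSol.comp_paraDil {F : E × (Sp n →L[ℝ] E) → E} (h : IsHeatSystemSol F V Ω)
    (w : Sp n × ℝ) {r : ℝ} (hF : ∀ v T, F (v, r • T) = r ^ 2 • F (v, T)) :
    IsHeatSystemSol F (V ∘ paraDil w r) (paraDil w r ⁻¹' Ω) := by
  refine ⟨h.isOpen.preimage (continuous_paraDil w r), ?_, fun v hv => ?_⟩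
  · refine h.smooth.comp (ContDiff.contDiffOn ?_) fun v hv => hv
    unfold paraDil; fun_prop
  · have hd := h.smooth.differentiableAt_of_isOpen h.isOpen hv
    have ht : ((r • (tdir n).1, r ^ 2 * (tdir n).2) : Sp n × ℝ) = r ^ 2 • tdir n := by
      simp [tdir]
    rw [fderiv_comp_paraDil hd, spatialFDeriv_comp_paraDil hd,
      spatialLaplacian_comp_paraDil h.isOpen h.smooth hv, hF, ht, map_smul, h.eqn _ hv, smul_add]
    rfl

lemma norm_iteratedFDeriv_comp_paraDil (V : Sp n × ℝ → E) (w : Sp n × ℝ) {r : ℝ} (hr : 0 < r)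
    (m : ℕ) :
    ‖iteratedFDeriv ℝ m (fun x => (V ∘ paraDil w r) (x, 0)) 0‖
      = r ^ m * ‖iteratedFDeriv ℝ m (fun x => V (x, w.2)) w.1‖ := by
  set g : Sp n ≃L[ℝ] Sp n := ContinuousLinearEquiv.smulLeft (Units.mk0 r hr.ne')
  have h1 : (fun x => (V ∘ paraDil w r) (x, 0))
      = (fun x => V (w.1 + x, w.2)) ∘ g := by
    funext x; simp [paraDil, g, Units.smul_def]
  have h2 := g.iteratedFDerivWithin_comp_right
    (fun x : Sp n => V (w.1 + x, w.2)) uniqueDiffOn_univ (x := 0) (mem_univ _) m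
  rw [preimage_univ, iteratedFDerivWithin_univ, iteratedFDerivWithin_univ,
    iteratedFDeriv_comp_add_left (f := fun x => V (x, w.2)), map_zero, add_zero] at h2
  rw [h1, h2]
  have h3 : (iteratedFDeriv ℝ m (fun x => V (x, w.2)) w.1).compContinuousLinearMap
      (fun _ => (g : Sp n →L[ℝ] Sp n)) = r ^ m • iteratedFDeriv ℝ m (fun x => V (x, w.2)) w.1 := by
    ext1 v
    have := (iteratedFDeriv ℝ m (fun x => V (x, w.2)) w.1).map_smul_univ (fun _ => r) v
    simpa [g, Units.smul_def] using this
  rw [h3, norm_smul, Real.norm_of_nonneg (by positivity)]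

end Rescale

/-! ### Small energy implies a gradient bound -/

section SmallEnergy

variable {n : ℕ}

/-- Derivative bounds at scale `r` for harmonic map heat flows with gradient of order `1 / r`. -/
theorem exists_norm_iteratedFDeriv_le_div (n k m : ℕ) (K : ℝ) :
    ∃ C : ℝ, ∀ (u : Sp n × ℝ → Fin k → ℝ) (Ω : Set (Sp n × ℝ)) (z : Sp n × ℝ) (r : ℝ), 0 < r →
      IsHeatSystemSol (sphereRHS n k) u Ω → closedCyl z r ⊆ Ω → (∀ w ∈ Ω, ‖u w‖ ≤ 1) →
      (∀ w ∈ closedCyl z r, r * ‖spatialFDeriv u w‖ ≤ K) →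
        ‖iteratedFDeriv ℝ m (fun x => u (x, z.2)) z.1‖ ≤ C / r ^ m := by
  obtain ⟨C, hC⟩ := exists_norm_iteratedFDeriv_le m (contDiff_sphereRHS (n := n) (k := k))
    one_pos (max 1 K)
  refine ⟨C, fun u Ω z r hr hu hsub h1 hK => ?_⟩
  rw [le_div_iff₀' (by positivity), ← norm_iteratedFDeriv_comp_paraDil u z hr m]
  have hmem : ∀ v ∈ closedCyl (0 : Sp n × ℝ) 1, paraDil z r v ∈ closedCyl z r := by
    intro v hv
    simpa [paraDil_zero] using paraDil_mem_closedCyl (w := z) hr.le hv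
  refine hC (u ∘ paraDil z r) _ 0 (hu.comp_paraDil z fun v T => sphereRHS_smul v r T)
    (fun v hv => hsub (hmem v hv)) fun v hv => max_le_max (h1 _ (hsub (hmem v hv))) ?_
  change ‖spatialFDeriv (u ∘ paraDil z r) v‖ ≤ K
  rw [spatialFDeriv_comp_paraDil
    (hu.smooth.differentiableAt_of_isOpen hu.isOpen (hsub (hmem v hv))), norm_smul,
    Real.norm_of_nonneg hr.le]
  exact hK _ (hmem v hv)

/-- The gradient of a harmonic map heat flow stays large near points where it is almost
maximal. -/
theorem exists_gradient_lower_bound (n k : ℕ) :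
    ∃ δ : ℝ, 0 < δ ∧ δ ≤ 1 ∧ ∀ (u : Sp n × ℝ → Fin k → ℝ) (Ω : Set (Sp n × ℝ)) (w : Sp n × ℝ)
      (r : ℝ), 0 < r → IsHeatSystemSol (sphereRHS n k) u Ω → closedCyl w r ⊆ Ω →
      (∀ v ∈ Ω, ‖u v‖ ≤ 1) → (∀ v ∈ closedCyl w r, r * ‖spatialFDeriv u v‖ ≤ 2) →
      r * ‖spatialFDeriv u w‖ = 1 →
        ∀ v ∈ closedCyl w (r * δ), 1 / 2 ≤ r * ‖spatialFDeriv u v‖ := by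
  obtain ⟨L, hL0, hL⟩ := exists_norm_sub_le (contDiff_sphereRHS (n := n) (k := k)).prolongRHS
    (linearGrowth_prolongRHS contDiff_sphereRHS) one_pos 2
  have hδ1 : 1 / (2 * (L + 1)) ≤ 1 / 2 := by
    rw [div_le_div_iff₀ (by positivity) (by norm_num)]; linarith
  refine ⟨1 / (2 * (L + 1)), by positivity, by linarith,
    fun u Ω w r hr hu hsub h1 h2 hw v hv => ?_⟩
  set δ := 1 / (2 * (L + 1)) with hδ
  have hδ0 : 0 < δ := by positivity
  have hmem : ∀ y ∈ closedCyl (0 : Sp n × ℝ) 1, paraDil w r y ∈ closedCyl w r := by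
    intro y hy
    simpa [paraDil_zero] using paraDil_mem_closedCyl (w := w) hr.le hy
  have hgrad : ∀ y ∈ closedCyl (0 : Sp n × ℝ) 1, ‖spatialFDeriv (u ∘ paraDil w r) y‖
      = r * ‖spatialFDeriv u (paraDil w r y)‖ := by
    intro y hy
    rw [spatialFDeriv_comp_paraDil
      (hu.smooth.differentiableAt_of_isOpen hu.isOpen (hsub (hmem y hy))), norm_smul,
      Real.norm_of_nonneg hr.le]
  obtain ⟨y, hy, rfl⟩ := exists_paraDil_eq hr hv
  have hy1 : y ∈ closedCyl (0 : Sp n × ℝ) 1 := closedCyl_mono 0 hδ0.le (by linarith) hy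
  have h01 : (0 : Sp n × ℝ) ∈ closedCyl (0 : Sp n × ℝ) 1 := mem_closedCyl_self 0 zero_le_one
  have key := hL (prolong (u ∘ paraDil w r)) _ 0
    ((hu.comp_paraDil w fun v T => sphereRHS_smul v r T).prolong contDiff_sphereRHS)
    (fun y hy => hsub (hmem y hy))
    (fun y hy => max_le ((h1 _ (hsub (hmem y hy))).trans one_le_two)
      ((hgrad y hy).trans_le (h2 _ (hmem y hy)))) y (closedCyl_mono 0 hδ0.le hδ1 hy)
  have hyn : ‖y - 0‖ ≤ δ := by
    obtain ⟨a1, a2, a3⟩ := hy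
    rw [sub_zero]
    refine max_le (by simpa using a1) (abs_le.2 ⟨?_, ?_⟩)
    · simp only [Prod.snd_zero] at a2; nlinarith
    · simp only [Prod.snd_zero] at a3; linarith
  have h3 : ‖spatialFDeriv (u ∘ paraDil w r) y - spatialFDeriv (u ∘ paraDil w r) 0‖ ≤ 1 / 2 := by
    have hLδ : L * δ ≤ 1 / 2 := by
      rw [hδ, mul_one_div, div_le_div_iff₀ (by positivity) (by norm_num)]; linarith
    calc _ ≤ ‖prolong (u ∘ paraDil w r) y - prolong (u ∘ paraDil w r) 0‖ :=
          norm_snd_le (prolong (u ∘ paraDil w r) y - prolong (u ∘ paraDil w r) 0)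
      _ ≤ L * δ := key.trans (mul_le_mul_of_nonneg_left hyn hL0)
      _ ≤ 1 / 2 := hLδ
  have h4 := hgrad 0 h01
  rw [paraDil_zero, hw] at h4
  rw [← hgrad y hy1]
  have := norm_sub_norm_le (spatialFDeriv (u ∘ paraDil w r) 0) (spatialFDeriv (u ∘ paraDil w r) y)
  rw [norm_sub_rev] at this
  linarith

lemma measurableSet_pcyl (w : Sp n × ℝ) (s : ℝ) : MeasurableSet (pcyl w s) :=
  isClosed_closedBall.measurableSet.prod measurableSet_Ioc

lemma pcyl_subset_closedCyl (w : Sp n × ℝ) (s : ℝ) : pcyl w s ⊆ closedCyl w s :=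
  prod_mono_right Ioc_subset_Icc_self

lemma volume_real_pcyl (w : Sp n × ℝ) {s : ℝ} (hs : 0 ≤ s) :
    volume.real (pcyl w s) = volume.real (ball (0 : Sp n) 1) * s ^ (n + 2) := by
  rw [pcyl, Measure.volume_eq_prod, measureReal_prod_prod, Measure.real, Measure.real,
    Measure.addHaar_closedBall _ _ hs, Real.volume_Ioc, ENNReal.toReal_mul,
    ENNReal.toReal_ofReal (by positivity), ENNReal.toReal_ofReal (by nlinarith [sq_nonneg s]),
    finrank_euclideanSpace_fin, Measure.real]
  ring

lemma le_setIntegral_pcyl {f : Sp n × ℝ → ℝ} {w : Sp n × ℝ} {s c : ℝ} (hs : 0 ≤ s)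
    (hf : ContinuousOn f (closedCyl w s)) (hc : ∀ v ∈ closedCyl w s, c ≤ f v) :
    volume.real (ball (0 : Sp n) 1) * s ^ (n + 2) * c ≤ ∫ v in pcyl w s, f v := by
  have hsub := pcyl_subset_closedCyl w s
  have hfin : volume (pcyl w s) ≠ ⊤ :=
    ((measure_mono hsub).trans_lt (isCompact_closedCyl w s).measure_lt_top).ne
  calc _ = ∫ _ in pcyl w s, c := by
        rw [setIntegral_const, volume_real_pcyl w hs, smul_eq_mul]
    _ ≤ _ := setIntegral_mono_on (integrableOn_const hfin)
      ((hf.integrableOn_compact (isCompact_closedCyl w s)).mono_set hsub)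
      (measurableSet_pcyl w s) fun v hv => hc v (hsub hv)

/-- Gradient bound for harmonic map heat flows with small parabolic Morrey energy. -/
theorem exists_small_energy_gradient_bound (n k : ℕ) (hn : 0 < n) {p : ℝ} (hp : 0 < p) :
    ∃ ε : ℝ, 0 < ε ∧ ∀ (u : Sp n × ℝ → Fin k → ℝ) (Ω : Set (Sp n × ℝ)) (z : Sp n × ℝ) (ρ : ℝ),
      0 < ρ → IsHeatSystemSol (sphereRHS n k) u Ω → closedCyl z ρ ⊆ Ω → (∀ v ∈ Ω, ‖u v‖ ≤ 1) →
      (∀ w r, 0 < r → closedCyl w r ⊆ closedCyl z ρ →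
        (r ^ (p - n - 2) * ∫ v in pcyl w r, (gradSq u v) ^ (p / 2)) ^ (1 / p) ≤ ε) →
        ρ * ‖spatialFDeriv u z‖ ≤ 2 := by
  obtain ⟨δ, hδ0, hδ1, hlow⟩ := exists_gradient_lower_bound n k
  have hn' : (0 : ℝ) < n := Nat.cast_pos.2 hn
  set b : ℝ := volume.real (ball (0 : Sp n) 1)
  have hb : 0 < b := ENNReal.toReal_pos (measure_ball_pos _ _ one_pos).ne' measure_ball_lt_top.ne
  set a : ℝ := δ / (2 * n) with ha
  have ha0 : 0 < a := by positivity
  refine ⟨(b * a ^ p) ^ (1 / p) / 2, by positivity, fun u Ω z ρ hρ hu hsub h1 hE => ?_⟩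
  by_contra! hcon
  obtain ⟨w, -, d, hd0, -, hwsub, hle, hhalf⟩ := exists_almost_max_subcylinder hρ.le
    (G := fun w => ‖spatialFDeriv u w‖)
    ((hu.smooth.spatialFDeriv hu.isOpen).continuousOn.mono hsub).norm fun _ => norm_nonneg _
  have hdl : 2 < d * ‖spatialFDeriv u w‖ := hcon.trans_le hle
  set l := ‖spatialFDeriv u w‖ with hl
  have hl0 : 0 < l := by
    by_contra! h
    nlinarith
  have hd : 0 < d := by
    by_contra! h
    nlinarith
  have hr : 0 < 1 / l := by positivity
  have hrd : 1 / l ≤ d / 2 := by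
    rw [div_le_div_iff₀ hl0 two_pos]; linarith
  have hsub1 : closedCyl w (1 / l) ⊆ closedCyl w (d / 2) := closedCyl_mono w hr.le hrd
  have hsub2 : closedCyl w (1 / l) ⊆ closedCyl z ρ :=
    (hsub1.trans (closedCyl_mono w (by linarith) (by linarith))).trans hwsub
  set s := 1 / l * δ with hs
  have hs0 : 0 < s := by positivity
  have hsub3 : closedCyl w s ⊆ closedCyl z ρ :=
    (closedCyl_mono w hs0.le (by rw [hs]; nlinarith)).trans hsub2
  have hgrad := hlow u Ω w (1 / l) hr hu (hsub2.trans hsub) h1 (fun v hv => by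
    have := hhalf v (hsub1 hv)
    have h2 : ‖spatialFDeriv u v‖ ≤ 2 * l := by
      refine le_of_mul_le_mul_left ?_ hd
      linarith
    rw [one_div, inv_mul_le_iff₀ hl0]; linarith) (by rw [← hl]; field_simp)
  have hpt : ∀ v ∈ closedCyl w s, (a / s) ^ p ≤ gradSq u v ^ (p / 2) := by
    intro v hv
    have h2 := hgrad v hv
    have h3 := norm_spatialFDeriv_le_sqrt_gradSq hu.isOpen hu.smooth (hsub (hsub3 hv))
    have h4 : a / s ≤ √(gradSq u v) := by
      have h5 : a / s = l / (2 * n) := by rw [ha, hs]; field_simp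
      rw [h5, div_le_iff₀ (by positivity)]
      rw [one_div_mul_eq_div, div_le_div_iff₀ two_pos hl0] at h2
      linarith
    calc (a / s) ^ p ≤ √(gradSq u v) ^ p := Real.rpow_le_rpow (by positivity) h4 hp.le
      _ = gradSq u v ^ (p / 2) := by
        have h0 : 0 ≤ gradSq u v :=
          Finset.sum_nonneg fun _ _ => Finset.sum_nonneg fun _ _ => sq_nonneg _
        rw [Real.sqrt_eq_rpow, ← Real.rpow_mul h0]; congr 1; ring
  have hcont : ContinuousOn (fun v => gradSq u v ^ (p / 2)) (closedCyl w s) :=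
    ((continuousOn_gradSq hu.isOpen hu.smooth).mono (hsub3.trans hsub)).rpow_const
      fun _ _ => Or.inr (by positivity)
  have hint := le_setIntegral_pcyl hs0.le hcont hpt
  have hscale : b * a ^ p = s ^ (p - n - 2) * (b * s ^ (n + 2) * (a / s) ^ p) := by
    have e1 : s ^ (p - n - 2) * (s ^ (n + 2) * (s ^ p)⁻¹) = 1 := by
      rw [← Real.rpow_natCast s (n + 2), ← Real.rpow_neg hs0.le, ← Real.rpow_add hs0,
        ← Real.rpow_add hs0]
      convert Real.rpow_zero s using 2
      push_cast; ring
    rw [Real.div_rpow ha0.le hs0.le, div_eq_mul_inv]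
    linear_combination (-(b * a ^ p)) * e1
  have hfin := hE w s hs0 hsub3
  have hge : (b * a ^ p) ^ (1 / p)
      ≤ (s ^ (p - n - 2) * ∫ v in pcyl w s, gradSq u v ^ (p / 2)) ^ (1 / p) := by
    refine Real.rpow_le_rpow (by positivity) ?_ (by positivity)
    rw [hscale]
    exact mul_le_mul_of_nonneg_left hint (by positivity)
  have hpos : 0 < (b * a ^ p) ^ (1 / p) := by positivity
  linarith

end SmallEnergy

/-! ### Spatial derivatives up to the top of the cylinder -/

section Slices

open scoped Pointwise

variable {n : ℕ} {E : Type*} [NormedAddCommGroup E] [NormedSpace ℝ E]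

lemma uniqueDiffOn_pcyl (z : Sp n × ℝ) {R : ℝ} (hR : 0 < R) : UniqueDiffOn ℝ (pcyl z R) := by
  refine UniqueDiffOn.prod (uniqueDiffOn_convex (convex_closedBall _ _) ?_) (uniqueDiffOn_Ioc _ _)
  exact ⟨z.1, ball_subset_interior_closedBall (mem_ball_self hR)⟩

lemma vadd_pcyl (z : Sp n × ℝ) (R t : ℝ) :
    ((0, t) : Sp n × ℝ) +ᵥ pcyl (z.1, z.2 - t) R = pcyl z R := by
  ext v
  rw [mem_vadd_set_iff_neg_vadd_mem]
  simp only [pcyl, mem_prod, vadd_eq_add, Prod.fst_add, Prod.snd_add, Prod.fst_neg, Prod.snd_neg,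
    neg_zero, zero_add, mem_Ioc]
  refine and_congr_right fun _ => ⟨fun h => ⟨?_, ?_⟩, fun h => ⟨?_, ?_⟩⟩ <;>
    linarith [h.1, h.2]

/-- Iterated derivatives of a time slice are restrictions of iterated spacetime derivatives. -/
lemma iteratedFDeriv_slice {V : Sp n × ℝ → E} {z : Sp n × ℝ} {R : ℝ} (hR : 0 < R)
    (hV : ContDiffOn ℝ (⊤ : ℕ∞) V (pcyl z R)) (m : ℕ) {t : ℝ} (ht : t ∈ Ioc (z.2 - R ^ 2) z.2) :
    iteratedFDeriv ℝ m (fun x => V (x, t)) z.1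
      = (iteratedFDerivWithin ℝ m V (pcyl z R) (z.1, t)).compContinuousLinearMap
        fun _ => ContinuousLinearMap.inl ℝ (Sp n) ℝ := by
  set S : Set (Sp n × ℝ) := pcyl (z.1, z.2 - t) R with hS
  have hpre : ContinuousLinearMap.inl ℝ (Sp n) ℝ ⁻¹' S = closedBall z.1 R := by
    ext x
    simp only [hS, pcyl, mem_preimage, ContinuousLinearMap.inl_apply, mem_prod, mem_Ioc,
      and_iff_left_iff_imp]
    exact fun _ => ⟨by linarith [ht.1], by linarith [ht.2]⟩
  have hmem : ContinuousLinearMap.inl ℝ (Sp n) ℝ z.1 ∈ S := by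
    rw [← mem_preimage, hpre]; exact mem_closedBall_self hR.le
  have hV' : ContDiffOn ℝ (⊤ : ℕ∞) (fun v => V (v + (0, t))) S := by
    refine hV.comp (contDiff_id.add contDiff_const).contDiffOn fun v hv => ?_
    have := vadd_mem_vadd_set (a := ((0, t) : Sp n × ℝ)) hv
    rwa [vadd_pcyl, vadd_eq_add, add_comm] at this
  have hU : UniqueDiffOn ℝ (closedBall z.1 R) := uniqueDiffOn_convex (convex_closedBall _ _)
    ⟨z.1, ball_subset_interior_closedBall (mem_ball_self hR)⟩
  have h1 := (ContinuousLinearMap.inl ℝ (Sp n) ℝ).iteratedFDerivWithin_comp_right hV'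
    (uniqueDiffOn_pcyl _ hR) (hpre ▸ hU) hmem (i := m) (by exact_mod_cast le_top)
  have hslice : (fun v : Sp n × ℝ => V (v + (0, t))) ∘ ContinuousLinearMap.inl ℝ (Sp n) ℝ
      = fun x => V (x, t) := by
    funext x; simp
  have hcd : ContDiffOn ℝ (⊤ : ℕ∞) (fun x => V (x, t)) (closedBall z.1 R) :=
    hV.comp (contDiff_id.prodMk contDiff_const).contDiffOn fun x hx => ⟨hx, ht⟩
  rw [hslice, hpre, iteratedFDerivWithin_eq_iteratedFDeriv hU
    ((hcd.contDiffAt (closedBall_mem_nhds _ hR)).of_le (by exact_mod_cast le_top))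
    (mem_closedBall_self hR.le), iteratedFDerivWithin_comp_add_right, vadd_pcyl] at h1
  simpa using h1

lemma continuousOn_iteratedFDeriv_slice {V : Sp n × ℝ → E} {z : Sp n × ℝ} {R : ℝ} (hR : 0 < R)
    (hV : ContDiffOn ℝ (⊤ : ℕ∞) V (pcyl z R)) (m : ℕ) :
    ContinuousOn (fun t => iteratedFDeriv ℝ m (fun x => V (x, t)) z.1)
      (Ioc (z.2 - R ^ 2) z.2) := by
  have h1 := hV.continuousOn_iteratedFDerivWithin (m := m) (by exact_mod_cast le_top)
    (uniqueDiffOn_pcyl z hR)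
  have h2 : ContinuousOn (fun t => iteratedFDerivWithin ℝ m V (pcyl z R) (z.1, t))
      (Ioc (z.2 - R ^ 2) z.2) :=
    h1.comp (by fun_prop) fun t ht => ⟨mem_closedBall_self hR.le, ht⟩
  exact ((ContinuousMultilinearMap.compContinuousLinearMapL (F := E)
    fun _ : Fin m => ContinuousLinearMap.inl ℝ (Sp n) ℝ).continuous.comp_continuousOn h2).congr
      fun t ht => iteratedFDeriv_slice hR hV m ht

end Slices

/-- ε-regularity (Theorem 2.1 of the paper, case N = S^{k-1}): interior gradient estimates
under parabolic Morrey smallness. -/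
theorem eps_regularity_heat_flow_sphere
    (n k : ℕ) (hn : 2 ≤ n) (hk : 2 ≤ k) (p : ℝ) (hp1 : 1 < p) (hp2 : p ≤ 2)
    (m : ℕ) (hm : 1 ≤ m) :
    ∃ ε C : ℝ, 0 < ε ∧ 0 < C ∧
      ∀ (z₀ : Sp n × ℝ) (R₀ : ℝ), 0 < R₀ →
      ∀ u : Sp n × ℝ → Fin k → ℝ,
        ContDiffOn ℝ (⊤ : ℕ∞) u (pcyl z₀ R₀) →
        SphereValued u (pcyl z₀ R₀) →
        HeatFlow u (pcyl z₀ R₀) →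
        (∀ z ∈ pcyl z₀ R₀, ∀ r : ℝ, 0 < r → r ≤ R₀ → pcyl z r ⊆ pcyl z₀ R₀ →
          (r ^ (p - n - 2) * ∫ w in pcyl z r, (gradSq u w) ^ (p / 2)) ^ (1 / p)
            + (r ^ (2 * p - n - 2) * ∫ w in pcyl z r, (dtSq u w) ^ (p / 2)) ^ (1 / p) ≤ ε) →
        ‖iteratedFDeriv ℝ m (fun x => u (x, z₀.2)) z₀.1‖ ≤ C * ε / R₀ ^ m := by
  obtain ⟨ε, hε, hsmall⟩ := exists_small_energy_gradient_bound n k (by omega) (zero_lt_one.trans hp1)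
  obtain ⟨C, hC⟩ := exists_norm_iteratedFDeriv_le_div n k m 2
  refine ⟨ε, (|C| * 4 ^ m + 1) / ε, hε, by positivity, fun z₀ R₀ hR u hu hS hH hE => ?_⟩
  set Ω : Set (Sp n × ℝ) := ball z₀.1 R₀ ×ˢ Ioo (z₀.2 - R₀ ^ 2) z₀.2 with hΩdef
  have hΩ : IsOpen Ω := isOpen_ball.prod isOpen_Ioo
  have hΩsub : Ω ⊆ pcyl z₀ R₀ := prod_mono ball_subset_closedBall Ioo_subset_Ioc_self
  have hsol : IsHeatSystemSol (sphereRHS n k) u Ω :=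
    HeatFlow.isHeatSystemSol hΩ (hu.mono hΩsub) fun z hz => hH z (hΩsub hz)
  have h1 : ∀ v ∈ Ω, ‖u v‖ ≤ 1 := fun v hv => hS.norm_le_one (hΩsub hv)
  have hR4 : 0 < R₀ / 2 / 2 := by positivity
  have hgrad : ∀ w, closedCyl w (R₀ / 2 / 2) ⊆ Ω → R₀ / 2 / 2 * ‖spatialFDeriv u w‖ ≤ 2 := by
    refine fun w hw => hsmall u Ω w _ hR4 hsol hw h1 fun y r hr hy => ?_
    have hyP : closedCyl y r ⊆ pcyl z₀ R₀ := (hy.trans hw).trans hΩsub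
    have hrR : r ≤ R₀ := by
      have a1 := hyP (mem_closedCyl_self y hr.le)
      have a2 : ((y.1, y.2 - r ^ 2) : Sp n × ℝ) ∈ pcyl z₀ R₀ :=
        hyP ⟨mem_closedBall_self hr.le, le_rfl, by nlinarith⟩
      have b1 : y.2 ≤ z₀.2 := a1.2.2
      have b2 : z₀.2 - R₀ ^ 2 < y.2 - r ^ 2 := a2.2.1
      nlinarith
    refine le_trans ?_ (hE y (hyP (mem_closedCyl_self y hr.le)) r hr hrR
      ((pcyl_subset_closedCyl y r).trans hyP))
    refine le_add_of_nonneg_right (Real.rpow_nonneg (mul_nonneg (by positivity) ?_) _)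
    exact integral_nonneg fun v =>
      Real.rpow_nonneg (Finset.sum_nonneg fun _ _ => sq_nonneg _) _
  have hbound : ∀ t ∈ Ioo (z₀.2 - R₀ ^ 2 / 4) z₀.2,
      ‖iteratedFDeriv ℝ m (fun x => u (x, t)) z₀.1‖ ≤ C / (R₀ / 2 / 2) ^ m := by
    intro t ht
    have hcyl : closedCyl ((z₀.1, t) : Sp n × ℝ) (R₀ / 2) ⊆ Ω := by
      rintro v ⟨hv1, hv2, hv3⟩
      dsimp only at hv1 hv2 hv3
      exact ⟨closedBall_subset_ball (by linarith) hv1, by nlinarith [ht.1],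
        hv3.trans_lt ht.2⟩
    refine hC u Ω (z₀.1, t) _ hR4 hsol
      ((closedCyl_mono _ hR4.le (by linarith)).trans hcyl) h1 fun w hw => hgrad w ?_
    exact (closedCyl_half_subset (by positivity) hw).trans hcyl
  have hlim : ‖iteratedFDeriv ℝ m (fun x => u (x, z₀.2)) z₀.1‖ ≤ C / (R₀ / 2 / 2) ^ m := by
    have hc := (continuousOn_iteratedFDeriv_slice hR hu m).norm z₀.2
      ⟨by nlinarith, le_rfl⟩
    have hnhds : Ioo (z₀.2 - R₀ ^ 2 / 4) z₀.2 ∈ 𝓝[<] z₀.2 := Ioo_mem_nhdsLT (by nlinarith)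
    have hle : 𝓝[<] z₀.2 ≤ 𝓝[Ioc (z₀.2 - R₀ ^ 2) z₀.2] z₀.2 :=
      nhdsWithin_le_of_mem (mem_of_superset (Ioo_mem_nhdsLT (by nlinarith)) Ioo_subset_Ioc_self)
    exact le_of_tendsto (hc.tendsto.mono_left hle) (mem_of_superset hnhds hbound)
  refine hlim.trans ?_
  have e1 : (|C| * 4 ^ m + 1) / ε * ε = |C| * 4 ^ m + 1 := div_mul_cancel₀ _ hε.ne'
  have e2 : (R₀ / 2 / 2) ^ m = R₀ ^ m / 4 ^ m := by rw [← div_pow]; congr 1; ring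
  rw [e1, e2, div_div_eq_mul_div]
  gcongr
  nlinarith [le_abs_self C, show (0 : ℝ) < 4 ^ m by positivity]
end
end

section
/- Let D ⊆ ℝⁿ × ℝ be open and let u = (u¹,…,u^k) : D → ℝ^k be a smooth map with |u(x,t)| = 1 for all (x,t) ∈ D which solves the harmonic map heat flow into the unit sphere S^{k−1}, i.e. ∂_t u^i − Δu^i = |∇u|² u^i on D for each i, where |∇u|² = Σ_{j,α} (∂_{x_α} u^j)². Then for every constant vector c = (c¹,…,c^k) ∈ ℝ^k and every index i, the following identity holds pointwise on D: ∂_t u^i − Δu^i = Σ_{α=1}^n ∂_{x_α} [ Σ_{j=1}^k (u^j − c^j)(u^i ∂_{x_α} u^j − u^j ∂_{x_α} u^i) ] − Σ_{j=1}^k (u^j − c^j)(u^i ∂_t u^j − u^j ∂_t u^i). -/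
open MeasureTheory Metric Set Filter Real

noncomputable section

theorem differentiableAt_component {n k : ℕ} {D : Set (Sp n × ℝ)} (hD : IsOpen D)
    {u : Sp n × ℝ → Fin k → ℝ} (hreg : ContDiffOn ℝ (⊤ : ℕ∞) u D)
    {z : Sp n × ℝ} (hz : z ∈ D) (i : Fin k) :
    DifferentiableAt ℝ (fun w => u w i) z :=
  (contDiffAt_pi.1 (hreg.contDiffAt (hD.mem_nhds hz)) i).differentiableAt (by simp)

theorem differentiableAt_pd {n k : ℕ} {D : Set (Sp n × ℝ)} (hD : IsOpen D)
    {u : Sp n × ℝ → Fin k → ℝ} (hreg : ContDiffOn ℝ (⊤ : ℕ∞) u D)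
    {z : Sp n × ℝ} (hz : z ∈ D) (i : Fin k) (v : Sp n × ℝ) :
    DifferentiableAt ℝ (pd u i v) z := by
  have h : ContDiffAt ℝ (⊤ : ℕ∞) (fun w => u w i) z :=
    contDiffAt_pi.1 (hreg.contDiffAt (hD.mem_nhds hz)) i
  have h' : ContDiffAt ℝ 1 (fderiv ℝ (fun w => u w i)) z :=
    h.fderiv_right (WithTop.coe_le_coe.2 le_top)
  exact (h'.differentiableAt one_ne_zero).clm_apply (differentiableAt_const v)

/-- A map into the unit sphere is orthogonal to each of its directional derivatives. -/
theorem SphereValued.sum_mul_pd_eq_zero {n k : ℕ} {D : Set (Sp n × ℝ)} (hD : IsOpen D)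
    {u : Sp n × ℝ → Fin k → ℝ} (hsph : SphereValued u D)
    {z : Sp n × ℝ} (hz : z ∈ D) (hu : ∀ i, DifferentiableAt ℝ (fun w => u w i) z)
    (v : Sp n × ℝ) :
    ∑ j, u z j * pd u j v z = 0 := by
  have hsum : HasFDerivAt (fun w => ∑ j, u w j ^ 2)
      (∑ j, (2 * u z j ^ 1) • fderiv ℝ (fun w => u w j) z) z :=
    HasFDerivAt.fun_sum fun j _ => by simpa using (hu j).hasFDerivAt.pow 2
  have hconst : HasFDerivAt (fun w => ∑ j, u w j ^ 2) (0 : Sp n × ℝ →L[ℝ] ℝ) z :=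
    (hasFDerivAt_const (1 : ℝ) z).congr_of_eventuallyEq
      (eventually_of_mem (hD.mem_nhds hz) hsph)
  have h := congrArg (fun L => L v) (hsum.unique hconst)
  simp only [sum_apply, smul_apply, smul_eq_mul,
    zero_apply, pow_one, mul_assoc, ← Finset.mul_sum] at h
  exact (mul_eq_zero.1 h).resolve_left two_ne_zero

/-- The directional derivative of `∑ j, (uʲ - cʲ) (uⁱ ∂ᵥuʲ - uʲ ∂ᵥuⁱ)` along `v`;
the products of first derivatives inside the bracket cancel. -/
theorem fderiv_sum_sub_mul_wedge {n k : ℕ} {u : Sp n × ℝ → Fin k → ℝ} {z : Sp n × ℝ}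
    (v : Sp n × ℝ) (hu : ∀ j, DifferentiableAt ℝ (fun w => u w j) z)
    (hpd : ∀ j, DifferentiableAt ℝ (pd u j v) z) (c : Fin k → ℝ) (i : Fin k) :
    fderiv ℝ (fun w => ∑ j, (u w j - c j) * (u w i * pd u j v w - u w j * pd u i v w)) z v =
      ∑ j, (pd u j v z * (u z i * pd u j v z - u z j * pd u i v z) +
        (u z j - c j) * (u z i * fderiv ℝ (pd u j v) z v - u z j * fderiv ℝ (pd u i v) z v)) := by
  have h := HasFDerivAt.fun_sum (u := Finset.univ) fun j _ =>
    ((hu j).hasFDerivAt.sub_const (c j)).fun_mul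
      (((hu i).hasFDerivAt.fun_mul (hpd j).hasFDerivAt).fun_sub
        ((hu j).hasFDerivAt.fun_mul (hpd i).hasFDerivAt))
  rw [h.fderiv, sum_apply]
  refine Finset.sum_congr rfl fun j _ => ?_
  simp only [add_apply, sub_apply,
    smul_apply, smul_eq_mul, pd]
  ring

/-- The div-curl rewriting (2.5) of the sphere-valued harmonic map heat flow equation
(Step 1 of the proof of Lemma 2.3). -/
theorem heat_flow_sphere_div_curl_identity
    (n k : ℕ) (D : Set (Sp n × ℝ)) (hD : IsOpen D)
    (u : Sp n × ℝ → Fin k → ℝ)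
    (hreg : ContDiffOn ℝ (⊤ : ℕ∞) u D)
    (hsph : SphereValued u D)
    (hflow : HeatFlow u D) :
    ∀ c : Fin k → ℝ, ∀ z ∈ D, ∀ i : Fin k,
      pd u i (tdir n) z - lap u i z =
        (∑ α : Fin n,
          fderiv ℝ
            (fun w => ∑ j : Fin k,
              (u w j - c j) * (u w i * pd u j (sdir n α) w - u w j * pd u i (sdir n α) w))
            z (sdir n α))
        - ∑ j : Fin k,
            (u z j - c j) * (u z i * pd u j (tdir n) z - u z j * pd u i (tdir n) z) := by
  intro c z hz i
  have hu := differentiableAt_component hD hreg hz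
  have hdiv (α : Fin n) := fderiv_sum_sub_mul_wedge (sdir n α) hu
    (fun j => differentiableAt_pd hD hreg hz j (sdir n α)) c i
  have hquad (α : Fin n) :
      ∑ j, pd u j (sdir n α) z * (u z i * pd u j (sdir n α) z - u z j * pd u i (sdir n α) z) =
        u z i * ∑ j, pd u j (sdir n α) z ^ 2 := by
    have h := hsph.sum_mul_pd_eq_zero hD hz hu (sdir n α)
    calc _ = u z i * ∑ j, pd u j (sdir n α) z ^ 2
          - pd u i (sdir n α) z * ∑ j, u z j * pd u j (sdir n α) z := by
            rw [Finset.mul_sum, Finset.mul_sum, ← Finset.sum_sub_distrib]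
            exact Finset.sum_congr rfl fun j _ => by ring
      _ = _ := by rw [h, mul_zero, sub_zero]
  have hlap : ∑ α, ∑ j, (u z j - c j) * (u z i * fderiv ℝ (pd u j (sdir n α)) z (sdir n α)
        - u z j * fderiv ℝ (pd u i (sdir n α)) z (sdir n α)) =
      ∑ j, (u z j - c j) * (u z i * lap u j z - u z j * lap u i z) := by
    rw [Finset.sum_comm]
    simp only [lap, ← Finset.mul_sum, Finset.sum_sub_distrib]
  have htime : ∑ j, (u z j - c j) * (u z i * pd u j (tdir n) z - u z j * pd u i (tdir n) z) =
      ∑ j, (u z j - c j) * (u z i * lap u j z - u z j * lap u i z) :=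
    Finset.sum_congr rfl fun j _ => by rw [hflow z hz i, hflow z hz j]; ring
  simp only [hdiv, Finset.sum_add_distrib, hquad]
  rw [hlap, htime, ← Finset.mul_sum, hflow z hz i, gradSq]
  ring
end
end
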